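/- arXiv:1102.5022 — 5 statements merged into one kernel-verified Lean document; each statement's English description precedes it below -/
import Mathlib

section
/- Let A be a commutative ring and let P^• = (0 → P^0 → P^1 → ⋯ → P^n → 0) be a bounded cochain complex of finitely generated projective A-modules. The following are equivalent: (1) H^j(P^•) = 0 for all j ≠ n, and H^n(P^•) is a finitely generated projective A-module; (2) for every ring homomorphism A → B (B commutative), H^j(P^• ⊗_A B) = 0 for all j ≠ n, and H^n(P^• ⊗_A B) is a finitely generated projective B-module; (3) for every maximal ideal 𝔪 of A, H^j(P^• ⊗_A A/𝔪) = 0 for all j ≠ n. -/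
open TensorProduct

namespace CochainCx

variable (R : Type) [CommRing R] (P : ℕ → Type)
  [∀ i, AddCommGroup (P i)] [∀ i, Module R (P i)]
  (d : ∀ i, P i →ₗ[R] P (i + 1))

/-- The cohomology of the cochain complex `P⁰ → P¹ → ⋯` (with differentials `d`):
`H⁰ = ker d⁰` and `H^{j+1} = ker d^{j+1} / (im d^j ∩ ker d^{j+1})`, which is the usual
cohomology `ker/im` whenever `d ∘ d = 0`. -/
noncomputable def cohomology : ℕ → Type
  | 0 => ↥(LinearMap.ker (d 0))
  | (j + 1) => ↥(LinearMap.ker (d (j + 1))) ⧸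
      Submodule.comap (LinearMap.ker (d (j + 1))).subtype (LinearMap.range (d j))

noncomputable instance : ∀ j, AddCommGroup (cohomology R P d j)
  | 0 => inferInstanceAs (AddCommGroup ↥(LinearMap.ker (d 0)))
  | (j + 1) => inferInstanceAs (AddCommGroup (↥(LinearMap.ker (d (j + 1))) ⧸
      Submodule.comap (LinearMap.ker (d (j + 1))).subtype (LinearMap.range (d j))))

noncomputable instance : ∀ j, Module R (cohomology R P d j)
  | 0 => inferInstanceAs (Module R ↥(LinearMap.ker (d 0)))
  | (j + 1) => inferInstanceAs (Module R (↥(LinearMap.ker (d (j + 1))) ⧸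
      Submodule.comap (LinearMap.ker (d (j + 1))).subtype (LinearMap.range (d j))))

end CochainCx

namespace LinearMap

variable {R : Type*} [CommRing R] {M N L : Type*} [AddCommGroup M] [Module R M]
  [AddCommGroup N] [Module R N] [AddCommGroup L] [Module R L]

/-- A map out of a projective module lifts along any map whose range contains its range. -/
theorem exists_comp_eq_of_range_le [Module.Projective R L] (f : M →ₗ[R] N) (g : L →ₗ[R] N)
    (h : ∀ x, ∃ y, f y = g x) : ∃ s : L →ₗ[R] M, f ∘ₗ s = g := by
  obtain ⟨s, hs⟩ := Module.projective_lifting_property f.rangeRestrict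
    (g.codRestrict (LinearMap.range f) h) f.surjective_rangeRestrict
  refine ⟨s, LinearMap.ext fun x => ?_⟩
  exact congrArg Subtype.val (LinearMap.congr_fun hs x)

/-- If `ρ` is a left inverse of `f` modulo the proper ideal `I`, then some multiple of the identity
by a scalar outside `I` factors through `f`. -/
theorem exists_comp_eq_smul_id_of_sub_mem [Module.Finite R M] (f : M →ₗ[R] N) (I : Ideal R)
    (ρ : N →ₗ[R] M) (hρ : ∀ x, x - ρ (f x) ∈ I • (⊤ : Submodule R M)) (hI : I ≠ ⊤) :
    ∃ c ∉ I, ∃ q : N →ₗ[R] M, q ∘ₗ f = c • LinearMap.id := by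
  obtain ⟨p, hp, -, hc, h0⟩ :=
    LinearMap.exists_monic_and_natDegree_eq_and_coeff_mem_pow_and_aeval_eq_zero
      R (1 - ρ ∘ₗ f : Module.End R M) I (by rintro _ ⟨x, rfl⟩; exact hρ x)
  refine ⟨p.eval 1, fun h => hI ((Ideal.eq_top_iff_one I).2 ?_), ?_⟩
  · have hmap : p.map (Ideal.Quotient.mk I) = Polynomial.X ^ p.natDegree := by
      ext k
      rw [Polynomial.coeff_map, Polynomial.coeff_X_pow]
      rcases lt_trichotomy k p.natDegree with hk | rfl | hk
      · rw [if_neg hk.ne, Ideal.Quotient.eq_zero_iff_mem]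
        exact Ideal.pow_le_self (Nat.sub_ne_zero_of_lt hk) (hc k)
      · simp [hp.coeff_natDegree]
      · simp [hk.ne', Polynomial.coeff_eq_zero_of_natDegree_lt hk]
    have := Polynomial.eval_map_apply (f := Ideal.Quotient.mk I) (p := p) 1
    rw [hmap, map_one, Ideal.Quotient.eq_zero_iff_mem.2 h] at this
    rw [← Ideal.Quotient.eq_zero_iff_mem, map_one]
    simpa using this
  · obtain ⟨q, hq⟩ := Polynomial.X_sub_C_dvd_sub_C_eval (a := (1 : R)) (p := p)
    have h := congrArg (Polynomial.aeval (1 - ρ ∘ₗ f : Module.End R M)) hq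
    rw [mul_comm, map_sub, h0, map_mul, map_sub, Polynomial.aeval_X, Polynomial.aeval_C,
      Polynomial.aeval_C, map_one, sub_sub_cancel_left, zero_sub, mul_neg, neg_inj] at h
    refine ⟨Polynomial.aeval (1 - ρ ∘ₗ f : Module.End R M) q ∘ₗ ρ, ?_⟩
    rw [LinearMap.comp_assoc, ← Module.End.mul_eq_comp, ← h, Algebra.algebraMap_eq_smul_one]
    rfl

/-- A map of finite projective modules which is injective modulo every maximal ideal has a left
inverse. -/
theorem exists_leftInverse_of_injective_baseChange_quotient [Module.Finite R M]
    [Module.Projective R N] (f : M →ₗ[R] N)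
    (hf : ∀ 𝔪 : Ideal R, 𝔪.IsMaximal → Function.Injective (f.baseChange (R ⧸ 𝔪))) :
    ∃ q : N →ₗ[R] M, q ∘ₗ f = LinearMap.id := by
  let I : Ideal R :=
    { carrier := {c | ∃ q : N →ₗ[R] M, q ∘ₗ f = c • LinearMap.id}
      add_mem' := by
        rintro a b ⟨q, hq⟩ ⟨r, hr⟩
        exact ⟨q + r, by rw [LinearMap.add_comp, hq, hr, add_smul]⟩
      zero_mem' := ⟨0, by simp⟩
      smul_mem' := by
        rintro a b ⟨q, hq⟩
        exact ⟨a • q, by rw [LinearMap.smul_comp, hq, smul_smul, smul_eq_mul]⟩ }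
  suffices h : I = ⊤ by
    obtain ⟨q, hq⟩ : (1 : R) ∈ I := h ▸ Submodule.mem_top
    exact ⟨q, by rw [hq, one_smul]⟩
  by_contra hI
  obtain ⟨𝔪, h𝔪, hle⟩ := I.exists_le_maximal hI
  let : Field (R ⧸ 𝔪) := Ideal.Quotient.field 𝔪
  obtain ⟨r, hr⟩ := LinearMap.exists_leftInverse_of_injective (f.baseChange (R ⧸ 𝔪))
    (LinearMap.ker_eq_bot.2 (hf 𝔪 h𝔪))
  have hsurj : Function.Surjective (TensorProduct.mk R (R ⧸ 𝔪) M 1) :=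
    TensorProduct.mk_surjective R M (R ⧸ 𝔪) Ideal.Quotient.mk_surjective
  obtain ⟨ρ, hρ⟩ := Module.projective_lifting_property (TensorProduct.mk R (R ⧸ 𝔪) M 1)
    (r.restrictScalars R ∘ₗ TensorProduct.mk R (R ⧸ 𝔪) N 1) hsurj
  obtain ⟨c, hc, hcI⟩ := f.exists_comp_eq_smul_id_of_sub_mem 𝔪 ρ (fun x => by
    have h1 : (1 : R ⧸ 𝔪) ⊗ₜ[R] ρ (f x) = r (1 ⊗ₜ f x) := LinearMap.congr_fun hρ (f x)
    have h2 : r (1 ⊗ₜ f x) = (1 : R ⧸ 𝔪) ⊗ₜ[R] x := LinearMap.congr_fun hr (1 ⊗ₜ x)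
    have h3 : (1 : R ⧸ 𝔪) ⊗ₜ[R] (x - ρ (f x)) = 0 := by
      rw [TensorProduct.tmul_sub, h1, h2, sub_self]
    have h4 := congrArg (TensorProduct.quotTensorEquivQuotSMul M 𝔪) h3
    rw [map_zero] at h4
    rwa [← map_one (Ideal.Quotient.mk 𝔪), TensorProduct.quotTensorEquivQuotSMul_mk_tmul,
      one_smul, Submodule.Quotient.mk_eq_zero] at h4) h𝔪.ne_top
  exact hc (hle hcI)

/-- If `g ∘ f = 0`, `f` has a generalized inverse `s`, and `L → M → N` is exact modulo every maximal
ideal, then the sequence is split exact at `M`. -/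
theorem exists_comp_add_comp_eq_id_of_exact_baseChange_quotient [Module.Finite R M]
    [Module.Projective R M] [Module.Projective R N] (f : L →ₗ[R] M) (g : M →ₗ[R] N)
    (hgf : g ∘ₗ f = 0) (s : M →ₗ[R] L) (hs : f ∘ₗ s ∘ₗ f = f)
    (hex : ∀ 𝔪 : Ideal R, 𝔪.IsMaximal → ∀ x, g.baseChange (R ⧸ 𝔪) x = 0 →
      ∃ y, f.baseChange (R ⧸ 𝔪) y = x) :
    ∃ b : N →ₗ[R] M, b ∘ₗ g + f ∘ₗ s = LinearMap.id := by
  obtain ⟨q, hq⟩ := (g.prod (f ∘ₗ s)).exists_leftInverse_of_injective_baseChange_quotient (by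
    intro 𝔪 h𝔪
    rw [injective_iff_map_eq_zero]
    intro x hx
    have hg : g.baseChange (R ⧸ 𝔪) x = 0 := by
      rw [← LinearMap.fst_prod g (f ∘ₗ s), LinearMap.baseChange_comp, LinearMap.comp_apply, hx,
        map_zero]
    have hfs : (f ∘ₗ s).baseChange (R ⧸ 𝔪) x = 0 := by
      rw [← LinearMap.snd_prod g (f ∘ₗ s), LinearMap.baseChange_comp, LinearMap.comp_apply, hx,
        map_zero]
    obtain ⟨y, rfl⟩ := hex 𝔪 h𝔪 x hg
    rw [← hfs, ← LinearMap.comp_apply, ← LinearMap.baseChange_comp, LinearMap.comp_assoc, hs])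
  refine ⟨q ∘ₗ LinearMap.inl R N M, LinearMap.ext fun x => ?_⟩
  have h1 : g (f (s x)) = 0 := LinearMap.congr_fun hgf (s x)
  have h2 : f (s (f (s x))) = f (s x) := LinearMap.congr_fun hs (s x)
  have h3 : q (g (x - f (s x)), f (s (x - f (s x)))) = x - f (s x) :=
    LinearMap.congr_fun hq (x - f (s x))
  rw [map_sub, map_sub, map_sub, h1, h2, sub_zero, sub_self] at h3
  simp [h3]

theorem exists_generalizedInverse_of_projective_quotient [Module.Projective R N]
    (f : M →ₗ[R] N) [Module.Projective R (N ⧸ LinearMap.range f)] :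
    ∃ s : N →ₗ[R] M, f ∘ₗ s ∘ₗ f = f := by
  obtain ⟨σ, hσ⟩ := Module.projective_lifting_property (LinearMap.range f).mkQ LinearMap.id
    (Submodule.mkQ_surjective _)
  obtain ⟨s, hs⟩ := f.exists_comp_eq_of_range_le
    (LinearMap.id - σ ∘ₗ (LinearMap.range f).mkQ) (fun x => by
      rw [← LinearMap.mem_range, ← Submodule.Quotient.mk_eq_zero]
      have := LinearMap.congr_fun hσ ((LinearMap.range f).mkQ x)
      simpa [sub_eq_zero] using this.symm)
  refine ⟨s, ?_⟩
  rw [← LinearMap.comp_assoc, hs]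
  ext x
  have : (LinearMap.range f).mkQ (f x) = 0 := by simp
  simp [-Submodule.mkQ_apply, this]

theorem projective_quotient_range_of_generalizedInverse [Module.Projective R N]
    (f : M →ₗ[R] N) (s : N →ₗ[R] M) (hs : f ∘ₗ s ∘ₗ f = f) :
    Module.Projective R (N ⧸ LinearMap.range f) := by
  refine Module.Projective.of_split
    ((LinearMap.range f).liftQ (LinearMap.id - f ∘ₗ s) ?_) (LinearMap.range f).mkQ ?_
  · rintro _ ⟨x, rfl⟩
    have : f (s (f x)) = f x := LinearMap.congr_fun hs x
    simp [this]
  · ext x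
    simp

end LinearMap

namespace CochainCx

section

variable {R : Type} [CommRing R] {P : ℕ → Type}
  [∀ i, AddCommGroup (P i)] [∀ i, Module R (P i)]
  {d : ∀ i, P i →ₗ[R] P (i + 1)}

theorem subsingleton_cohomology_zero_iff :
    Subsingleton (cohomology R P d 0) ↔ ∀ x, d 0 x = 0 → x = 0 := by
  change Subsingleton (LinearMap.ker (d 0)) ↔ _
  rw [Submodule.subsingleton_iff_eq_bot, LinearMap.ker_eq_bot']

theorem subsingleton_cohomology_succ_iff (j : ℕ) :
    Subsingleton (cohomology R P d (j + 1)) ↔ ∀ x, d (j + 1) x = 0 → ∃ y, d j y = x := by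
  change Subsingleton (LinearMap.ker (d (j + 1)) ⧸ _) ↔ _
  rw [Submodule.Quotient.subsingleton_iff, Submodule.comap_subtype_eq_top]
  rfl

theorem subsingleton_cohomology_of_subsingleton (j : ℕ) [Subsingleton (P j)] :
    Subsingleton (cohomology R P d j) := by
  cases j with
  | zero => exact subsingleton_cohomology_zero_iff.2 fun x _ => Subsingleton.elim _ _
  | succ j =>
    exact (subsingleton_cohomology_succ_iff j).2 fun x _ => ⟨0, Subsingleton.elim _ _⟩

/-- In the top degree `0`, the cohomology is the whole term. -/
noncomputable def cohomologyZeroEquiv [Subsingleton (P 1)] : cohomology R P d 0 ≃ₗ[R] P 0 :=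
  LinearEquiv.ofTop (LinearMap.ker (d 0))
    (LinearMap.ker_eq_top.2 (LinearMap.ext fun _ => Subsingleton.elim _ _))

/-- In a positive top degree, the cohomology is the cokernel of the last differential. -/
noncomputable def cohomologySuccEquiv (j : ℕ) [Subsingleton (P (j + 2))] :
    cohomology R P d (j + 1) ≃ₗ[R] P (j + 1) ⧸ LinearMap.range (d j) :=
  have h : LinearMap.ker (d (j + 1)) = ⊤ :=
    LinearMap.ker_eq_top.2 (LinearMap.ext fun _ => Subsingleton.elim (α := P (j + 2)) _ _)
  Submodule.Quotient.equiv
    (Submodule.comap (LinearMap.ker (d (j + 1))).subtype (LinearMap.range (d j)))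
    (LinearMap.range (d j)) (LinearEquiv.ofTop _ h) (by
      change Submodule.map (LinearMap.ker (d (j + 1))).subtype _ = _
      rw [Submodule.map_comap_subtype, h, top_inf_eq])

variable (d) in
/-- A contracting homotopy exists in the given degree. -/
def SplitAt : ℕ → Prop
  | 0 => ∃ b : P 1 →ₗ[R] P 0, b ∘ₗ d 0 = LinearMap.id
  | j + 1 => ∃ (a : P (j + 1) →ₗ[R] P j) (b : P (j + 2) →ₗ[R] P (j + 1)),
      b ∘ₗ d (j + 1) + d j ∘ₗ a = LinearMap.id

theorem SplitAt.subsingleton_cohomology {j : ℕ} (h : SplitAt d j) :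
    Subsingleton (cohomology R P d j) := by
  cases j with
  | zero =>
    obtain ⟨b, hb⟩ := h
    refine subsingleton_cohomology_zero_iff.2 fun x hx => ?_
    simpa [hx] using (LinearMap.congr_fun hb x).symm
  | succ j =>
    obtain ⟨a, b, hb⟩ := h
    refine (subsingleton_cohomology_succ_iff j).2 fun x hx => ⟨a x, ?_⟩
    simpa [hx] using LinearMap.congr_fun hb x

theorem SplitAt.exists_generalizedInverse {j : ℕ} (h : SplitAt d j)
    (hdd : ∀ i, d (i + 1) ∘ₗ d i = 0) :
    ∃ s : P (j + 1) →ₗ[R] P j, d j ∘ₗ s ∘ₗ d j = d j := by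
  cases j with
  | zero =>
    obtain ⟨b, hb⟩ := h
    exact ⟨b, by rw [hb, LinearMap.comp_id]⟩
  | succ j =>
    obtain ⟨a, b, hb⟩ := h
    exact ⟨b, by rw [eq_sub_of_add_eq hb, LinearMap.comp_sub, ← LinearMap.comp_assoc, hdd,
      LinearMap.zero_comp, LinearMap.comp_id, sub_zero]⟩

theorem SplitAt.baseChange {j : ℕ} (h : SplitAt d j) (B : Type) [CommRing B] [Algebra R B] :
    SplitAt (P := fun i => B ⊗[R] P i) (fun i => (d i).baseChange B) j := by
  cases j with
  | zero =>
    obtain ⟨b, hb⟩ := h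
    exact ⟨b.baseChange B, by rw [← LinearMap.baseChange_comp, hb, LinearMap.baseChange_id]⟩
  | succ j =>
    obtain ⟨a, b, hb⟩ := h
    exact ⟨a.baseChange B, b.baseChange B, by
      rw [← LinearMap.baseChange_comp, ← LinearMap.baseChange_comp, ← LinearMap.baseChange_add,
        hb, LinearMap.baseChange_id]⟩

theorem finite_projective_cohomology_of_splitAt [∀ i, Module.Finite R (P i)]
    [∀ i, Module.Projective R (P i)] (hdd : ∀ i, d (i + 1) ∘ₗ d i = 0) {n : ℕ}
    (hbound : ∀ i, n < i → Subsingleton (P i)) (h : ∀ j < n, SplitAt d j) :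
    (∀ j, j ≠ n → Subsingleton (cohomology R P d j)) ∧
      Module.Finite R (cohomology R P d n) ∧ Module.Projective R (cohomology R P d n) := by
  refine ⟨fun j hj => ?_, ?_⟩
  · rcases hj.lt_or_gt with hj | hj
    · exact (h j hj).subsingleton_cohomology
    · have := hbound j hj
      exact subsingleton_cohomology_of_subsingleton j
  · have := hbound (n + 1) n.lt_succ_self
    cases n with
    | zero =>
      exact ⟨.equiv cohomologyZeroEquiv.symm, .of_equiv cohomologyZeroEquiv.symm⟩
    | succ n =>
      obtain ⟨s, hs⟩ := (h n n.lt_succ_self).exists_generalizedInverse hdd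
      have := (d n).projective_quotient_range_of_generalizedInverse s hs
      exact ⟨.equiv (cohomologySuccEquiv n).symm, .of_equiv (cohomologySuccEquiv n).symm⟩

/-- The homotopy is built by descending induction from the splitting of the last differential. -/
theorem splitAt_of_projective_cohomology [∀ i, Module.Projective R (P i)]
    (hdd : ∀ i, d (i + 1) ∘ₗ d i = 0) {n : ℕ} (hbound : ∀ i, n < i → Subsingleton (P i))
    (hvan : ∀ j, j ≠ n → Subsingleton (cohomology R P d j))
    [hproj : Module.Projective R (cohomology R P d n)] : ∀ j < n, SplitAt d j := by
  have lift (j : ℕ) (hj : j + 1 < n) (s : P (j + 2) →ₗ[R] P (j + 1))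
      (hs : d (j + 1) ∘ₗ s ∘ₗ d (j + 1) = d (j + 1)) :
      ∃ a : P (j + 1) →ₗ[R] P j, d j ∘ₗ a = LinearMap.id - s ∘ₗ d (j + 1) := by
    refine (d j).exists_comp_eq_of_range_le _ fun x =>
      (subsingleton_cohomology_succ_iff j).1 (hvan _ hj.ne) _ ?_
    have : d (j + 1) (s (d (j + 1) x)) = d (j + 1) x := LinearMap.congr_fun hs x
    simp [this]
  have reg (j : ℕ) (hj : j + 1 ≤ n) : ∃ s : P (j + 1) →ₗ[R] P j, d j ∘ₗ s ∘ₗ d j = d j := by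
    obtain ⟨k, hk⟩ := Nat.exists_eq_add_of_le hj
    induction k generalizing j with
    | zero =>
      obtain rfl : n = j + 1 := hk
      have := hbound (j + 2) (Nat.lt_succ_self _)
      have : Module.Projective R (P (j + 1) ⧸ LinearMap.range (d j)) :=
        .of_equiv (cohomologySuccEquiv j)
      exact (d j).exists_generalizedInverse_of_projective_quotient
    | succ k ih =>
      obtain ⟨s, hs⟩ := ih (j + 1) (by omega) (by omega)
      obtain ⟨a, ha⟩ := lift j (by omega) s hs
      refine ⟨a, ?_⟩
      rw [← LinearMap.comp_assoc, ha, LinearMap.sub_comp, LinearMap.comp_assoc, hdd,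
        LinearMap.comp_zero, sub_zero, LinearMap.id_comp]
  intro j hj
  obtain ⟨s, hs⟩ := reg j hj
  cases j with
  | zero =>
    refine ⟨s, LinearMap.ext fun x => ?_⟩
    have := subsingleton_cohomology_zero_iff.1 (hvan 0 hj.ne) (s (d 0 x) - x) (by
      rw [map_sub, sub_eq_zero]; exact LinearMap.congr_fun hs x)
    exact sub_eq_zero.1 this
  | succ j =>
    obtain ⟨a, ha⟩ := lift j hj s hs
    exact ⟨a, s, by rw [ha, add_sub_cancel]⟩

/-- The homotopy is built by ascending induction. -/
theorem splitAt_of_forall_maximal [∀ i, Module.Finite R (P i)]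
    [∀ i, Module.Projective R (P i)] (hdd : ∀ i, d (i + 1) ∘ₗ d i = 0) {n : ℕ}
    (h : ∀ 𝔪 : Ideal R, 𝔪.IsMaximal → ∀ j, j ≠ n →
      Subsingleton (cohomology (R ⧸ 𝔪) (fun i => (R ⧸ 𝔪) ⊗[R] P i)
        (fun i => (d i).baseChange (R ⧸ 𝔪)) j)) : ∀ j < n, SplitAt d j := by
  intro j hj
  induction j with
  | zero =>
    exact (d 0).exists_leftInverse_of_injective_baseChange_quotient fun 𝔪 h𝔪 =>
      (injective_iff_map_eq_zero _).2 (subsingleton_cohomology_zero_iff.1 (h 𝔪 h𝔪 0 hj.ne))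
  | succ j ih =>
    obtain ⟨s, hs⟩ := (ih (Nat.lt_of_succ_lt hj)).exists_generalizedInverse hdd
    exact ⟨s, (d j).exists_comp_add_comp_eq_id_of_exact_baseChange_quotient (d (j + 1)) (hdd j) s
      hs fun 𝔪 h𝔪 => (subsingleton_cohomology_succ_iff j).1 (h 𝔪 h𝔪 (j + 1) hj.ne)⟩

end

end CochainCx

open CochainCx in
/-- `P` is a cochain complex of finitely generated projective `R`-modules
concentrated in degrees `0,…,n`; the three conditions of the proposition are equivalent.
Base change along a ring map `R → B` is expressed by regarding `B` as an `R`-algebra. -/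
theorem stmt_0 (R : Type) [CommRing R] (n : ℕ) (P : ℕ → Type)
    [∀ i, AddCommGroup (P i)] [∀ i, Module R (P i)]
    [∀ i, Module.Finite R (P i)] [∀ i, Module.Projective R (P i)]
    (d : ∀ i, P i →ₗ[R] P (i + 1))
    (hdd : ∀ i, (d (i + 1)).comp (d i) = 0)
    (hbound : ∀ i, n < i → Subsingleton (P i)) :
    List.TFAE [
      -- (1)
      (∀ j, j ≠ n → Subsingleton (cohomology R P d j)) ∧
        Module.Finite R (cohomology R P d n) ∧ Module.Projective R (cohomology R P d n),
      -- (2): for every commutative `R`-algebra `B` (i.e. every ring hom `R → B`)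
      (∀ (B : Type) [CommRing B] [Algebra R B],
        (∀ j, j ≠ n → Subsingleton (cohomology B (fun i => B ⊗[R] P i)
            (fun i => LinearMap.baseChange B (d i)) j)) ∧
          Module.Finite B (cohomology B (fun i => B ⊗[R] P i)
            (fun i => LinearMap.baseChange B (d i)) n) ∧
          Module.Projective B (cohomology B (fun i => B ⊗[R] P i)
            (fun i => LinearMap.baseChange B (d i)) n)),
      -- (3): for every maximal ideal `𝔪` of `R`
      (∀ 𝔪 : Ideal R, 𝔪.IsMaximal → ∀ j, j ≠ n →
        Subsingleton (cohomology (R ⧸ 𝔪) (fun i => (R ⧸ 𝔪) ⊗[R] P i)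
          (fun i => LinearMap.baseChange (R ⧸ 𝔪) (d i)) j))] := by
  tfae_have 1 → 2 := fun ⟨hvan, _, hproj⟩ B _ _ => by
    have hB (i : ℕ) (hi : n < i) : Subsingleton (B ⊗[R] P i) := by
      have := hbound i hi
      infer_instance
    exact finite_projective_cohomology_of_splitAt
      (fun i => by rw [← LinearMap.baseChange_comp, hdd, LinearMap.baseChange_zero]) hB
      fun j hj => (splitAt_of_projective_cohomology hdd hbound hvan j hj).baseChange B
  tfae_have 2 → 3 := fun h 𝔪 _ => (h (R ⧸ 𝔪)).1
  tfae_have 3 → 1 := fun h => finite_projective_cohomology_of_splitAt hdd hbound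
    (splitAt_of_forall_maximal hdd h)
  tfae_finish
end

section
/- Let p be a prime, r ≥ 1, and let G be a finite abelian group isomorphic to (ℤ/p)^r. Then the reduced simplicial homology of the order complex of proper nontrivial subgroups of G satisfies: H̃_q(C̃_•(P_G)) = 0 for all q ≠ r − 2, and H̃_{r−2}(C̃_•(P_G)) is a free abelian group. -/
namespace OrderComplex

variable (V : Type) [Preorder V]

/-- The `q`-simplices of the order complex of `V`: strictly increasing chains
`v 0 < v 1 < ⋯ < v q` of elements of `V`. -/
def Simplex (q : ℕ) : Type _ := {f : Fin (q + 1) → V // StrictMono f}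

/-- The group `C̃_q` of `q`-chains: the free abelian group on the `q`-simplices. -/
abbrev Chains (q : ℕ) : Type _ := Simplex V q →₀ ℤ

variable {V}

/-- The `i`-th face of a simplex, obtained by omitting its `i`-th vertex. -/
def face {q : ℕ} (s : Simplex V (q + 1)) (i : Fin (q + 2)) : Simplex V q :=
  ⟨s.1 ∘ i.succAbove, s.2.comp (Fin.strictMono_succAbove i)⟩

variable (V)

/-- The simplicial boundary map `∂ : C̃_{q+1} → C̃_q`, the alternating sum of the face maps. -/
noncomputable def boundary (q : ℕ) : Chains V (q + 1) →ₗ[ℤ] Chains V q :=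
  Finsupp.linearCombination ℤ fun s : Simplex V (q + 1) =>
    ∑ i : Fin (q + 2), ((-1 : ℤ) ^ (i : ℕ)) • Finsupp.single (face s i) 1

/-- The augmentation `C̃_0 → C̃_{-1} = ℤ`, sending each vertex to `1`. -/
noncomputable def augment : Chains V 0 →ₗ[ℤ] ℤ :=
  Finsupp.linearCombination ℤ fun _ : Simplex V 0 => (1 : ℤ)

/-- The homology of the augmented chain complex
`⋯ → C̃_1 → C̃_0 → C̃_{-1} = ℤ → 0`, indexed so that `reducedHomology V n` is the homology
`H̃_{n-1}` at the term `C̃_{n-1}` (so `n = 0` corresponds to the term `ℤ` in degree `-1`).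
Since no differential is available out of degree `-1`, homology in an ambient degree `q` is
`ker ∂ / (im ∂ ∩ ker ∂)`, which agrees with `ker ∂ / im ∂` since `∂ ∘ ∂ = 0`. -/
noncomputable def reducedHomology : ℕ → Type _
  | 0 => ℤ ⧸ LinearMap.range (augment V)
  | 1 => ↥(LinearMap.ker (augment V)) ⧸
      Submodule.comap (LinearMap.ker (augment V)).subtype (LinearMap.range (boundary V 0))
  | (q + 2) => ↥(LinearMap.ker (boundary V q)) ⧸
      Submodule.comap (LinearMap.ker (boundary V q)).subtype
        (LinearMap.range (boundary V (q + 1)))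

noncomputable instance : ∀ n, AddCommGroup (reducedHomology V n)
  | 0 => inferInstanceAs (AddCommGroup (ℤ ⧸ LinearMap.range (augment V)))
  | 1 => inferInstanceAs (AddCommGroup (↥(LinearMap.ker (augment V)) ⧸
      Submodule.comap (LinearMap.ker (augment V)).subtype (LinearMap.range (boundary V 0))))
  | (q + 2) => inferInstanceAs (AddCommGroup (↥(LinearMap.ker (boundary V q)) ⧸
      Submodule.comap (LinearMap.ker (boundary V q)).subtype
        (LinearMap.range (boundary V (q + 1)))))

noncomputable instance : ∀ n, Module ℤ (reducedHomology V n)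
  | 0 => inferInstanceAs (Module ℤ (ℤ ⧸ LinearMap.range (augment V)))
  | 1 => inferInstanceAs (Module ℤ (↥(LinearMap.ker (augment V)) ⧸
      Submodule.comap (LinearMap.ker (augment V)).subtype (LinearMap.range (boundary V 0))))
  | (q + 2) => inferInstanceAs (Module ℤ (↥(LinearMap.ker (boundary V q)) ⧸
      Submodule.comap (LinearMap.ker (boundary V q)).subtype
        (LinearMap.range (boundary V (q + 1)))))

end OrderComplex

namespace ListChain

open Finsupp

variable {α : Type}

/-- Prepend the vertex `x` to every list. -/
noncomputable def cons (x : α) : (List α →₀ ℤ) →ₗ[ℤ] (List α →₀ ℤ) :=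
  lmapDomain ℤ ℤ (List.cons x)

/-- Append the vertex `k` to every list. -/
noncomputable def append (k : α) : (List α →₀ ℤ) →ₗ[ℤ] (List α →₀ ℤ) :=
  lmapDomain ℤ ℤ (· ++ [k])

/-- The boundary of a list of vertices, the empty list being the `(-1)`-simplex. -/
noncomputable def listBoundary : List α → (List α →₀ ℤ)
  | [] => 0
  | x :: l => single l 1 - cons x (listBoundary l)

/-- The augmented boundary map on the free abelian group on lists. -/
noncomputable def bd : (List α →₀ ℤ) →ₗ[ℤ] (List α →₀ ℤ) := linearCombination ℤ listBoundary

/-- The map induced by a map of vertices. -/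
noncomputable def map {β : Type} (f : α → β) : (List α →₀ ℤ) →ₗ[ℤ] (List β →₀ ℤ) :=
  lmapDomain ℤ ℤ (List.map f)

/-- The prism of a list between its image under `f` and itself. -/
noncomputable def listPrism (f : α → α) : List α → (List α →₀ ℤ)
  | [] => 0
  | x :: l => single (f x :: x :: l) 1 - cons (f x) (listPrism f l)

/-- The prism operator, a chain homotopy between `map f` and the identity. -/
noncomputable def prism (f : α → α) : (List α →₀ ℤ) →ₗ[ℤ] (List α →₀ ℤ) :=
  linearCombination ℤ (listPrism f)

open Classical in
/-- Keep the lists with head `x`, and remove their head. -/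
noncomputable def uncons (x : α) : (List α →₀ ℤ) →ₗ[ℤ] (List α →₀ ℤ) :=
  linearCombination ℤ fun l => if l.head? = some x then single l.tail 1 else 0

@[simp] lemma cons_single (x : α) (l : List α) (c : ℤ) :
    cons x (single l c) = single (x :: l) c := by simp [cons]

@[simp] lemma append_single (x : α) (l : List α) (c : ℤ) :
    append x (single l c) = single (l ++ [x]) c := by simp [append]

@[simp] lemma map_single {β : Type} (f : α → β) (l : List α) (c : ℤ) :
    map f (single l c) = single (l.map f) c := by simp [map]

@[simp] lemma bd_nil : bd (single ([] : List α) 1) = 0 := by simp [bd, listBoundary]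

@[simp] lemma bd_cons (x : α) (z : List α →₀ ℤ) : bd (cons x z) = z - cons x (bd z) := by
  suffices bd ∘ₗ cons x = LinearMap.id - cons x ∘ₗ bd by
    simpa using LinearMap.congr_fun this z
  ext1 l
  ext1
  simp [bd, listBoundary]

@[simp] lemma prism_nil (f : α → α) : prism f (single ([] : List α) 1) = 0 := by
  simp [prism, listPrism]

@[simp] lemma prism_cons (f : α → α) (x : α) (z : List α →₀ ℤ) :
    prism f (cons x z) = cons (f x) (cons x z) - cons (f x) (prism f z) := by
  suffices prism f ∘ₗ cons x = cons (f x) ∘ₗ cons x - cons (f x) ∘ₗ prism f by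
    simpa using LinearMap.congr_fun this z
  ext1 l
  ext1
  simp [prism, listPrism]

@[simp] lemma map_cons {β : Type} (f : α → β) (x : α) (z : List α →₀ ℤ) :
    map f (cons x z) = cons (f x) (map f z) := by
  suffices map f ∘ₗ cons x = cons (f x) ∘ₗ map f by simpa using LinearMap.congr_fun this z
  ext1 l
  ext1
  simp

@[simp] lemma append_cons (k x : α) (z : List α →₀ ℤ) :
    append k (cons x z) = cons x (append k z) := by
  suffices append k ∘ₗ cons x = cons x ∘ₗ append k by simpa using LinearMap.congr_fun this z
  ext1 l
  ext1
  simp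

lemma single_cons (x : α) (l : List α) : single (x :: l) (1 : ℤ) = cons x (single l 1) := by simp

/-- Two linear maps on list chains agree if they do so on lists. -/
lemma eq_of_lists {M : Type} [AddCommGroup M] {f g : (List α →₀ ℤ) →ₗ[ℤ] M}
    (h : ∀ l, f (single l 1) = g (single l 1)) : f = g := by
  ext1 l
  ext1
  simpa using h l

/-- Two linear maps agree on the chains supported on `S` if they do so on the lists in `S`. -/
lemma eqOn_supported {M : Type} [AddCommGroup M] {f g : (List α →₀ ℤ) →ₗ[ℤ] M}
    {S : Set (List α)} (h : ∀ l ∈ S, f (single l 1) = g (single l 1)) {z : List α →₀ ℤ}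
    (hz : z ∈ supported ℤ ℤ S) : f z = g z := by
  rw [supported_eq_span_single] at hz
  refine LinearMap.eqOn_span ?_ hz
  rintro _ ⟨l, hl, rfl⟩
  exact h l hl

/-- A linear map sends chains supported on `S` into `N` if it does so on the lists in `S`. -/
lemma mem_of_supported {M : Type} [AddCommGroup M] {f : (List α →₀ ℤ) →ₗ[ℤ] M}
    {S : Set (List α)} {N : Submodule ℤ M} (h : ∀ l ∈ S, f (single l 1) ∈ N) {z : List α →₀ ℤ}
    (hz : z ∈ supported ℤ ℤ S) : f z ∈ N := by
  rw [supported_eq_span_single] at hz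
  refine (Submodule.span_le (p := N.comap f)).2 ?_ hz
  rintro _ ⟨l, hl, rfl⟩
  exact h l hl

lemma single_mem {S : Set (List α)} {l : List α} (h : l ∈ S) :
    single l (1 : ℤ) ∈ supported ℤ ℤ S := single_mem_supported ℤ 1 h

lemma bd_bd (z : List α →₀ ℤ) : bd (bd z) = 0 := by
  refine LinearMap.congr_fun (f := bd ∘ₗ bd) (g := 0) (eq_of_lists fun l => ?_) z
  induction l with
  | nil => simp
  | cons x l ih =>
    simp only [LinearMap.comp_apply, LinearMap.zero_apply] at ih ⊢
    rw [single_cons, bd_cons, map_sub, bd_cons, ih, map_zero, sub_zero, sub_self]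

lemma bd_map {β : Type} (f : α → β) (z : List α →₀ ℤ) : bd (map f z) = map f (bd z) := by
  refine LinearMap.congr_fun (f := bd ∘ₗ map f) (g := map f ∘ₗ bd) (eq_of_lists fun l => ?_) z
  induction l with
  | nil => simp
  | cons x l ih =>
    simp only [LinearMap.comp_apply] at ih ⊢
    rw [single_cons, map_cons, bd_cons, bd_cons, ih, map_sub, map_cons]

lemma prism_homotopy (f : α → α) (z : List α →₀ ℤ) :
    bd (prism f z) + prism f (bd z) = z - map f z := by
  refine LinearMap.congr_fun (f := bd ∘ₗ prism f + prism f ∘ₗ bd) (g := LinearMap.id - map f)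
    (eq_of_lists fun l => ?_) z
  induction l with
  | nil => simp
  | cons x l ih =>
    simp only [LinearMap.comp_apply, LinearMap.add_apply, LinearMap.sub_apply,
      LinearMap.id_apply] at ih ⊢
    have ih' : bd (prism f (single l 1)) =
      single l 1 - map f (single l 1) - prism f (bd (single l 1)) := eq_sub_of_add_eq ih
    simp only [single_cons, map_cons, bd_cons, prism_cons, map_sub, ih']
    abel

lemma bd_append (k : α) {m : ℕ} {z : List α →₀ ℤ}
    (hz : z ∈ supported ℤ ℤ {l : List α | l.length = m}) :
    bd (append k z) = append k (bd z) + (-1 : ℤ) ^ m • z := by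
  refine eqOn_supported (f := bd ∘ₗ append k) (g := append k ∘ₗ bd + (-1 : ℤ) ^ m • LinearMap.id)
    ?_ hz
  clear hz
  rintro l rfl
  induction l with
  | nil =>
    have : bd (single [k] 1) = single ([] : List α) 1 := by rw [single_cons, bd_cons]; simp
    simp [this]
  | cons x l ih =>
    simp only [LinearMap.comp_apply, LinearMap.add_apply, LinearMap.smul_apply,
      LinearMap.id_apply] at ih ⊢
    rw [single_cons, append_cons, bd_cons, bd_cons, ih]
    simp only [map_add, map_sub, map_smul, append_cons, List.length_cons, pow_succ]
    simp only [mul_neg, mul_one, neg_smul]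
    abel

lemma bd_ofFn {q : ℕ} (s : Fin (q + 1) → α) :
    bd (single (List.ofFn s) 1) =
      ∑ i : Fin (q + 1), (-1 : ℤ) ^ (i : ℕ) • single (List.ofFn (s ∘ i.succAbove)) 1 := by
  induction q with
  | zero =>
    rw [List.ofFn_succ, single_cons, bd_cons]
    simp
  | succ q ih =>
    rw [List.ofFn_succ, single_cons, bd_cons, ih, Fin.sum_univ_succ (n := q + 1), map_sum,
      sub_eq_add_neg, ← Finset.sum_neg_distrib]
    congr 1
    · simp [Function.comp_def]
    · refine Finset.sum_congr rfl fun i _ => ?_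
      rw [List.ofFn_succ (f := s ∘ i.succ.succAbove)]
      simp [pow_succ, Function.comp_def]

/-- The lists with two equal consecutive vertices span a subcomplex. -/
lemma bd_degenerate {z : List α →₀ ℤ}
    (hz : z ∈ supported ℤ ℤ {l : List α | ¬ l.IsChain (· ≠ ·)}) :
    bd z ∈ supported ℤ ℤ {l : List α | ¬ l.IsChain (· ≠ ·)} := by
  have hcons (x : α) {z : List α →₀ ℤ}
      (hz : z ∈ supported ℤ ℤ {l : List α | ¬ l.IsChain (· ≠ ·)}) :
      cons x z ∈ supported ℤ ℤ {l : List α | ¬ l.IsChain (· ≠ ·)} := by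
    refine mem_of_supported (fun l hl => ?_) hz
    rw [cons_single]
    exact single_mem fun h => hl h.tail
  refine mem_of_supported (fun l hl => ?_) hz
  induction l with
  | nil => simp at hl
  | cons x l ih =>
    rw [single_cons, bd_cons]
    by_cases h : l.IsChain (· ≠ ·)
    · match l with
      | [] => simp at hl
      | y :: l =>
        obtain rfl : x = y := by
          by_contra hxy
          exact hl (List.isChain_cons_cons.2 ⟨hxy, h⟩)
        rw [single_cons, bd_cons, map_sub, sub_sub_cancel]
        refine mem_of_supported (f := cons x ∘ₗ cons x) (S := Set.univ) (fun l _ => ?_) (by simp)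
        simpa using single_mem (S := {l : List α | ¬ l.IsChain (· ≠ ·)}) (l := x :: x :: l) (by simp)
    · exact sub_mem (single_mem h) (hcons x (ih h))

lemma uncons_cons (x : α) (z : List α →₀ ℤ) : uncons x (cons x z) = z := by
  refine LinearMap.congr_fun (f := uncons x ∘ₗ cons x) (g := .id) (eq_of_lists fun l => ?_) z
  simp [uncons]

lemma uncons_eq_zero {x : α} {S : Set (List α)} (h : ∀ l ∈ S, x ∉ l) {z : List α →₀ ℤ}
    (hz : z ∈ supported ℤ ℤ S) : uncons x z = 0 := by
  refine eqOn_supported (g := 0) (fun l hl => ?_) hz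
  have : l.head? ≠ some x := fun h' => h l hl (List.mem_of_head? h')
  simp [uncons, this]

end ListChain

namespace ListChain

open Finsupp

section Lattice

variable {L : Type} [Lattice L] [BoundedOrder L]

/-- The strictly increasing lists of length `m` in the open interval from `a` to `⊤`. -/
def Strict (a : L) (m : ℕ) : Set (List L) :=
  {l | l.Pairwise (· < ·) ∧ l.length = m ∧ ∀ x ∈ l, a < x ∧ x < ⊤}

/-- The weakly increasing lists of length `m` in the open interval from `a` to `⊤`. -/
def Weak (a : L) (m : ℕ) : Set (List L) :=
  {l | l.Pairwise (· ≤ ·) ∧ l.length = m ∧ ∀ x ∈ l, a < x ∧ x < ⊤}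

/-- A strict cycle bounding a chain of weakly increasing lists bounds a strict chain. -/
lemma exists_strict_of_weak {a : L} {m : ℕ} {z w : List L →₀ ℤ}
    (hz : z ∈ supported ℤ ℤ (Strict a m)) (hw : w ∈ supported ℤ ℤ (Weak a (m + 1)))
    (h : bd w = z) : ∃ v ∈ supported ℤ ℤ (Strict a (m + 1)), bd v = z := by
  classical
  have hne {b : L} {n : ℕ} {l : List L} (hl : l ∈ Strict b n) : l.IsChain (· ≠ ·) :=
    hl.1.isChain.imp fun _ _ => ne_of_lt
  have hbd {l : List L} (hl : l ∈ Strict a (m + 1)) :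
      bd (single l 1) ∈ supported ℤ ℤ {l : List L | l.Pairwise (· < ·)} := by
    have key : ∀ l : List L, l.Pairwise (· < ·) →
        bd (single l 1) ∈ supported ℤ ℤ {l' : List L | l'.Pairwise (· < ·) ∧ l' ⊆ l} := by
      intro l hl
      induction l with
      | nil => simp
      | cons x l ih =>
        rw [List.pairwise_cons] at hl
        rw [single_cons, bd_cons]
        refine sub_mem (single_mem ⟨hl.2, by simp⟩) (mem_of_supported ?_ (ih hl.2))
        rintro l' ⟨h1, h2⟩
        rw [cons_single]
        exact single_mem ⟨List.pairwise_cons.2 ⟨fun y hy => hl.1 y (h2 hy), h1⟩,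
          List.cons_subset_cons _ h2⟩
    exact supported_mono (fun l' hl' => hl'.1) (key l hl.1)
  let v := w.filter (·.IsChain (· ≠ ·))
  have hv : v ∈ supported ℤ ℤ (Strict a (m + 1)) := by
    rw [mem_supported]
    intro l hl
    simp only [v, support_filter, Finset.coe_filter, Set.mem_ofPred_eq] at hl
    obtain ⟨h1, h2, h3⟩ := hw hl.1
    refine ⟨List.isChain_iff_pairwise.1 ?_, h2, h3⟩
    rw [List.isChain_iff_getElem] at hl ⊢
    exact fun i hi => (List.pairwise_iff_getElem.1 h1 i (i + 1) _ hi (by omega)).lt_of_ne (hl.2 i hi)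
  refine ⟨v, hv, ?_⟩
  have hu : w - v ∈ supported ℤ ℤ {l : List L | ¬ l.IsChain (· ≠ ·)} := by
    rw [mem_supported']
    intro l hl
    simp only [Set.mem_ofPred_eq, not_not] at hl
    simp [v, hl]
  have h1 := bd_degenerate hu
  rw [map_sub, h] at h1
  have h2 : z - bd v ∈ supported ℤ ℤ {l : List L | l.IsChain (· ≠ ·)} := by
    refine sub_mem (supported_mono (fun l hl => hne hl) hz) ?_
    refine mem_of_supported (fun l hl => ?_) hv
    exact supported_mono (fun l hl => hl.isChain.imp fun _ _ => ne_of_lt) (hbd hl)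
  have h3 : z - bd v = 0 := by
    refine (Submodule.disjoint_def.1 (disjoint_supported_supported ?_)) _ h2 h1
    exact disjoint_compl_right
  exact (sub_eq_zero.1 h3).symm

/-- The prism over an increasing list is made of increasing lists. -/
lemma prism_mem (k : L) {l : List L} (hl : l.Pairwise (· ≤ ·)) :
    prism (· ⊓ k) (single l 1) ∈ supported ℤ ℤ {l' : List L | l'.Pairwise (· ≤ ·) ∧
      l'.length = l.length + 1 ∧ ∀ y ∈ l', ∃ x ∈ l, y = x ∨ y = x ⊓ k} := by
  induction l with
  | nil => simp
  | cons x l ih =>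
    rw [List.pairwise_cons] at hl
    rw [single_cons, prism_cons]
    refine sub_mem ?_ (mem_of_supported ?_ (ih hl.2))
    · rw [cons_single, cons_single]
      refine single_mem ⟨?_, by simp, ?_⟩
      · simp only [List.pairwise_cons, List.mem_cons, forall_eq_or_imp]
        exact ⟨⟨inf_le_left, fun y hy => inf_le_left.trans (hl.1 y hy)⟩, hl.1, hl.2⟩
      · simp only [List.mem_cons]
        rintro y (rfl | rfl | hy)
        · exact ⟨x, by simp⟩
        · exact ⟨y, by simp⟩
        · exact ⟨y, by simp [hy]⟩
    · rintro l' ⟨h1, h2, h3⟩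
      rw [cons_single]
      refine single_mem ⟨List.pairwise_cons.2 ⟨fun y hy => ?_, h1⟩, by simp [h2], ?_⟩
      · obtain ⟨u, hu, rfl | rfl⟩ := h3 y hy
        · exact inf_le_left.trans (hl.1 _ hu)
        · exact inf_le_inf_right k (hl.1 _ hu)
      · simp only [List.mem_cons]
        rintro y (rfl | hy)
        · exact ⟨x, by simp⟩
        · obtain ⟨u, hu, h⟩ := h3 y hy
          exact ⟨u, .inr hu, h⟩

/-- The part of the open interval from `a` to `⊤` whose elements meet `k` above `a` is
contractible to `k`. -/
lemma exists_of_forall_lt_inf {a k : L} (hak : a < k) (hk : k < ⊤) {m : ℕ} {z : List L →₀ ℤ}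
    (hz : z ∈ supported ℤ ℤ {l | l ∈ Strict a m ∧ ∀ x ∈ l, a < x ⊓ k}) (hd : bd z = 0) :
    ∃ w ∈ supported ℤ ℤ (Strict a (m + 1)), bd w = z := by
  have hmap : map (· ⊓ k) z ∈ supported ℤ ℤ
      {l : List L | l.length = m ∧ l.Pairwise (· ≤ ·) ∧ ∀ x ∈ l, a < x ∧ x ≤ k} := by
    refine mem_of_supported ?_ hz
    rintro l ⟨⟨h1, h2, h3⟩, h4⟩
    rw [map_single]
    refine single_mem ⟨by simp [h2], ?_, ?_⟩
    · rw [List.pairwise_map]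
      exact h1.imp fun h => inf_le_inf_right k h.le
    · simp only [List.mem_map]
      rintro _ ⟨x, hx, rfl⟩
      exact ⟨h4 x hx, inf_le_right⟩
  refine exists_strict_of_weak (w := prism (· ⊓ k) z + (-1 : ℤ) ^ m • append k (map (· ⊓ k) z))
    (supported_mono (fun l hl => hl.1) hz) (add_mem ?_ (Submodule.smul_mem _ _ ?_)) ?_
  · refine mem_of_supported ?_ hz
    rintro l ⟨⟨h1, h2, h3⟩, h4⟩
    refine supported_mono ?_ (prism_mem k (h1.imp le_of_lt))
    rintro l' ⟨h1', h2', h3'⟩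
    refine ⟨h1', by rw [h2', h2], fun y hy => ?_⟩
    obtain ⟨x, hx, rfl | rfl⟩ := h3' y hy
    · exact h3 _ hx
    · exact ⟨h4 x hx, inf_le_left.trans_lt (h3 x hx).2⟩
  · refine mem_of_supported ?_ hmap
    rintro l ⟨h1, h2, h3⟩
    rw [append_single]
    refine single_mem ⟨?_, by simp [h1], ?_⟩
    · rw [List.pairwise_append]
      exact ⟨h2, by simp, fun x hx y hy => by
        rw [List.mem_singleton.1 hy]; exact (h3 x hx).2⟩
    · simp only [List.mem_append, List.mem_singleton]
      rintro x (hx | rfl)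
      · exact ⟨(h3 x hx).1, (h3 x hx).2.trans_lt hk⟩
      · exact ⟨hak, hk⟩
  · have h1 := prism_homotopy (· ⊓ k) z
    rw [hd, map_zero, add_zero] at h1
    rw [map_add, map_smul, bd_append k (supported_mono (fun l hl => hl.1) hmap), bd_map, hd, h1,
      map_zero, map_zero, zero_add, smul_smul, ← mul_pow]
    simp

/-- Removing the head `x` anticommutes with the boundary when `x` covers `a`. -/
lemma bd_uncons {a x : L} (hx : a ⋖ x) {m : ℕ} {z : List L →₀ ℤ}
    (hz : z ∈ supported ℤ ℤ (Strict a m)) : bd (uncons x z) = - uncons x (bd z) := by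
  refine eqOn_supported (f := bd ∘ₗ uncons x) (g := -(uncons x ∘ₗ bd)) (fun l hl => ?_) hz
  simp only [LinearMap.comp_apply, LinearMap.neg_apply]
  obtain ⟨h1, -, h3⟩ := hl
  match l with
  | [] => simp [uncons]
  | y :: l =>
    rw [List.pairwise_cons] at h1
    have hxl : x ∉ l := fun h => hx.2 (h3 y (by simp)).1 (h1.1 x h)
    have h0 : uncons x (single l 1) = 0 :=
      uncons_eq_zero (S := {l}) (by simpa using hxl) (single_mem rfl)
    rw [single_cons, bd_cons, map_sub, h0]
    by_cases hxy : y = x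
    · subst hxy
      rw [uncons_cons, uncons_cons]
      simp
    · have (w : List L →₀ ℤ) : uncons x (cons y w) = 0 := by
        refine LinearMap.congr_fun (f := uncons x ∘ₗ cons y) (g := 0) (eq_of_lists fun l => ?_) w
        simp [uncons, hxy]
      rw [this, this]
      simp

lemma uncons_mem {a x : L} {m : ℕ} {z : List L →₀ ℤ}
    (hz : z ∈ supported ℤ ℤ (Strict a (m + 1))) : uncons x z ∈ supported ℤ ℤ (Strict x m) := by
  refine mem_of_supported (fun l hl => ?_) hz
  obtain ⟨h1, h2, h3⟩ := hl
  match l with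
  | [] => simp [uncons]
  | y :: l =>
    rw [List.pairwise_cons] at h1
    by_cases hxy : y = x
    · subst hxy
      rw [single_cons, uncons_cons]
      exact single_mem ⟨h1.2, by simpa using h2, fun u hu => ⟨h1.1 u hu, (h3 u (by simp [hu])).2⟩⟩
    · simp [uncons, hxy]

/-- Open intervals `(a, ⊤)` of a finite modular lattice, graded by the corank `c`, have vanishing
reduced homology below the top degree. -/
theorem exists_bd_eq [IsModularLattice L] [Finite L] {c : L → ℕ}
    (hcov : ∀ a b, a ⋖ b → c a = c b + 1) (htop : c ⊤ = 0) (n : ℕ) : ∀ (a : L), c a = n → ∀ (m : ℕ), m + 1 < n →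
    ∀ z ∈ supported ℤ ℤ (Strict a m), bd z = 0 →
      ∃ w ∈ supported ℤ ℤ (Strict a (m + 1)), bd w = z := by
  classical
  have := Fintype.ofFinite L
  induction n with
  | zero => intro a _ m hm; omega
  | succ n ih =>
    intro a ha m hm z hz hd
    obtain rfl | ⟨k, hk, hak⟩ := eq_top_or_exists_le_coatom a
    · omega
    have hk' : k ⋖ ⊤ := hk.covBy_top
    have hak' : a < k := hak.lt_of_ne (by
      rintro rfl
      have := hcov _ _ hk'
      omega)
    have hbad {x : L} (hx : a < x) (hxk : ¬ a < x ⊓ k) : a ⋖ x := by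
      have h1 : x ⊓ k = a := ((le_inf hx.le hak).eq_of_not_lt hxk).symm
      have h2 : x ⊔ k = ⊤ := by
        refine (hk.2 _ (right_lt_sup.2 fun h => ?_))
        rw [inf_eq_left.2 h] at h1
        exact hx.ne' h1
      rw [← h1]
      rw [← h2] at hk'
      rw [inf_comm]
      rw [sup_comm] at hk'
      exact inf_covBy_of_covBy_sup_left hk'
    let bad : Finset L := {x | a ⋖ x ∧ ¬ a < x ⊓ k}
    have hu (x : L) (hx : x ∈ bad) : ∃ u ∈ supported ℤ ℤ (Strict x m), bd u = uncons x z := by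
      simp only [bad, Finset.mem_filter, Finset.mem_univ, true_and] at hx
      match m with
      | 0 =>
        refine ⟨0, zero_mem _, ?_⟩
        rw [map_zero, uncons_eq_zero _ hz]
        rintro l ⟨-, h, -⟩
        simp [List.length_eq_zero_iff.1 h]
      | m + 1 =>
        refine ih x (by have := hcov _ _ hx.1; omega) m (by omega) _ (uncons_mem hz) ?_
        rw [bd_uncons hx.1 hz, hd]
        simp
    choose! u hu hud using hu
    have hgood : z - ∑ x ∈ bad, cons x (uncons x z) ∈
        supported ℤ ℤ {l | l ∈ Strict a m ∧ ∀ x ∈ l, a < x ⊓ k} := by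
      have : z - ∑ x ∈ bad, cons x (uncons x z) =
        (LinearMap.id - ∑ x ∈ bad, cons x ∘ₗ uncons x : _ →ₗ[ℤ] (List L →₀ ℤ)) z := by simp
      rw [this]
      refine mem_of_supported (fun l hl => ?_) hz
      simp only [LinearMap.sub_apply, LinearMap.id_apply, LinearMap.sum_apply,
        LinearMap.comp_apply]
      have hl' := hl
      obtain ⟨h1, h2, h3⟩ := hl
      have htail {y : L} {t : List L} (h1 : (y :: t).Pairwise (· < ·)) (hy : a < y) :
          ∀ x ∈ t, a < x ⊓ k := by
        intro x hx
        by_contra h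
        have hyx := (List.pairwise_cons.1 h1).1 x hx
        exact (hbad (hy.trans hyx) h).2 hy hyx
      by_cases hl : ∀ x ∈ l, a < x ⊓ k
      · rw [Finset.sum_eq_zero, sub_zero]
        · exact single_mem ⟨hl', hl⟩
        · intro x hx
          rw [uncons_eq_zero (S := {l}) _ (single_mem rfl), map_zero]
          rintro _ rfl hxl
          exact (Finset.mem_filter.1 hx).2.2 (hl x hxl)
      · match l with
        | [] => simp at hl
        | y :: t =>
          have hy := (h3 y (by simp)).1
          have hyk : ¬ a < y ⊓ k := fun h => hl (by
            simp only [List.mem_cons, forall_eq_or_imp]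
            exact ⟨h, htail h1 hy⟩)
          have hyb : y ∈ bad := by simpa [bad, hyk] using hbad hy hyk
          rw [Finset.sum_eq_single_of_mem y hyb]
          · rw [single_cons, uncons_cons, sub_self]
            exact zero_mem _
          · intro x _ hxy
            simp [uncons, hxy.symm]
    have hz' : z + ∑ x ∈ bad, bd (cons x (u x)) ∈
        supported ℤ ℤ {l | l ∈ Strict a m ∧ ∀ x ∈ l, a < x ⊓ k} := by
      have : z + ∑ x ∈ bad, bd (cons x (u x)) =
          (z - ∑ x ∈ bad, cons x (uncons x z)) + ∑ x ∈ bad, u x := by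
        rw [Finset.sum_congr rfl fun x hx => (bd_cons x (u x)).trans (by rw [hud x hx]),
          Finset.sum_sub_distrib]
        abel
      rw [this]
      refine add_mem hgood (sum_mem fun x hx => supported_mono ?_ (hu x hx))
      have hx' := (Finset.mem_filter.1 hx).2.1
      rintro l ⟨h1, h2, h3⟩
      refine ⟨⟨h1, h2, fun y hy => ⟨hx'.lt.trans (h3 y hy).1, (h3 y hy).2⟩⟩, fun y hy => ?_⟩
      by_contra h
      exact (hbad (hx'.lt.trans (h3 y hy).1) h).2 hx'.lt (h3 y hy).1
    obtain ⟨v, hv, hvz⟩ := exists_of_forall_lt_inf hak' hk.lt_top hz' (by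
      rw [map_add, hd, map_sum, Finset.sum_eq_zero fun x _ => bd_bd _, add_zero])
    refine ⟨v - ∑ x ∈ bad, cons x (u x), sub_mem hv (sum_mem fun x hx => ?_), ?_⟩
    · have hx' := (Finset.mem_filter.1 hx).2.1
      refine mem_of_supported (fun l hl => ?_) (hu x hx)
      obtain ⟨h1, h2, h3⟩ := hl
      rw [cons_single]
      refine single_mem ⟨List.pairwise_cons.2 ⟨fun y hy => (h3 y hy).1, h1⟩, by simp [h2], ?_⟩
      simp only [List.mem_cons, forall_eq_or_imp]
      refine ⟨⟨hx'.lt, lt_top_iff_ne_top.2 ?_⟩, fun y hy =>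
        ⟨hx'.lt.trans (h3 y hy).1, (h3 y hy).2⟩⟩
      rintro rfl
      have := hcov _ _ hx'
      omega
    · rw [map_sub, hvz, map_sum, add_sub_cancel_right]

end Lattice

end ListChain

namespace ListChain

open Finsupp OrderComplex

section Comparison

variable {L : Type} [Lattice L] [BoundedOrder L]

/-- The chains of the order complex of the proper part of `L`, as list chains. -/
noncomputable def toLists (q : ℕ) :
    Chains {H : L // H ≠ ⊥ ∧ H ≠ ⊤} q →ₗ[ℤ] (List L →₀ ℤ) :=
  lmapDomain ℤ ℤ fun s => List.ofFn fun i => (s.1 i).1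

lemma toLists_single (q : ℕ) (s : Simplex {H : L // H ≠ ⊥ ∧ H ≠ ⊤} q) (c : ℤ) :
    toLists q (single s c) = single (List.ofFn fun i => (s.1 i).1) c := by simp [toLists]

lemma toLists_injective (q : ℕ) : Function.Injective (toLists (L := L) q) := by
  refine mapDomain_injective fun s t h => Subtype.ext (funext fun i => Subtype.ext ?_)
  exact congr_fun (List.ofFn_injective h) i

lemma toLists_mem (q : ℕ) (z : Chains {H : L // H ≠ ⊥ ∧ H ≠ ⊤} q) :
    toLists q z ∈ supported ℤ ℤ (Strict (⊥ : L) (q + 1)) := by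
  induction z using Finsupp.induction_linear with
  | zero => simp
  | add f g hf hg => rw [map_add]; exact add_mem hf hg
  | single s c =>
    rw [toLists_single]
    refine single_mem_supported ℤ c ⟨List.pairwise_ofFn.2 fun i j h => s.2 h, by simp, ?_⟩
    simp only [List.mem_ofFn]
    rintro _ ⟨i, rfl⟩
    exact ⟨bot_lt_iff_ne_bot.2 (s.1 i).2.1, lt_top_iff_ne_top.2 (s.1 i).2.2⟩

lemma exists_toLists_eq {q : ℕ} {w : List L →₀ ℤ}
    (hw : w ∈ supported ℤ ℤ (Strict (⊥ : L) (q + 1))) :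
    ∃ z, toLists q z = w := by
  refine LinearMap.mem_range.1 (mem_of_supported (f := .id) (fun l hl => ?_) hw)
  obtain ⟨h1, h2, h3⟩ := hl
  have hmem (i : Fin (q + 1)) := h3 (l.get (i.cast h2.symm)) (List.get_mem _ _)
  let s : Simplex {H : L // H ≠ ⊥ ∧ H ≠ ⊤} q :=
    ⟨fun i => ⟨l.get (i.cast h2.symm), (hmem i).1.ne', (hmem i).2.ne⟩,
      fun i j h => List.pairwise_iff_get.1 h1 _ _ (by simpa using h)⟩
  refine ⟨single s 1, ?_⟩
  rw [toLists_single, LinearMap.id_apply]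
  congr 1
  exact List.ext_get (by simp [h2]) (fun n _ _ => by simp [s, -List.ofFn_succ])

lemma toLists_boundary (q : ℕ) (z : Chains {H : L // H ≠ ⊥ ∧ H ≠ ⊤} (q + 1)) :
    toLists q (boundary _ q z) = bd (toLists (q + 1) z) := by
  suffices toLists q ∘ₗ boundary {H : L // H ≠ ⊥ ∧ H ≠ ⊤} q = bd ∘ₗ toLists (q + 1) from
    LinearMap.congr_fun this z
  ext1 s
  ext1
  simp only [LinearMap.comp_apply, lsingle_apply, boundary, linearCombination_single, one_smul,
    map_sum, map_smul, toLists_single, bd_ofFn]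
  rfl

lemma single_augment (z : Chains {H : L // H ≠ ⊥ ∧ H ≠ ⊤} 0) :
    single [] (augment _ z) = bd (toLists 0 z) := by
  suffices lsingle [] ∘ₗ augment {H : L // H ≠ ⊥ ∧ H ≠ ⊤} = bd ∘ₗ toLists 0 from
    LinearMap.congr_fun this z
  ext1 s
  ext1
  simp only [LinearMap.comp_apply, lsingle_apply, augment, linearCombination_single, one_smul,
    toLists_single, bd_ofFn]
  simp

/-- A simplex of the proper part has fewer vertices than the corank of `⊥`. -/
lemma lt_corank_of_simplex {c : L → ℕ} (hc : StrictAnti c) {q : ℕ}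
    (s : Simplex {H : L // H ≠ ⊥ ∧ H ≠ ⊤} q) : q + 1 < c ⊥ := by
  have hinj : Function.Injective fun i => c (s.1 i).1 :=
    StrictAnti.injective fun i j h => hc (s.2 h)
  have h := Finset.card_le_card_of_injOn (s := Finset.univ) (t := Finset.Ioo 0 (c ⊥))
    (fun i => c (s.1 i).1) (fun i _ => ?_) hinj.injOn
  · have h0 := hc (bot_lt_iff_ne_bot.2 (s.1 0).2.1)
    simp only [Finset.card_univ, Fintype.card_fin, Nat.card_Ioo] at h
    omega
  · simp only [Finset.coe_Ioo, Set.mem_Ioo]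
    exact ⟨(Nat.zero_le _).trans_lt (hc (lt_top_iff_ne_top.2 (s.1 i).2.2)),
      hc (bot_lt_iff_ne_bot.2 (s.1 i).2.1)⟩

/-- The homology of the proper part of a graded finite modular lattice is free and concentrated
in the top degree. -/
theorem reducedHomology_properPart [IsModularLattice L] [Finite L] {c : L → ℕ} (hc : StrictAnti c)
    (hcov : ∀ a b, a ⋖ b → c a = c b + 1) (htop : c ⊤ = 0) (hbot : 1 ≤ c ⊥) :
    (∀ n, n ≠ c ⊥ - 1 → Subsingleton (reducedHomology {H : L // H ≠ ⊥ ∧ H ≠ ⊤} n)) ∧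
      Module.Free ℤ (reducedHomology {H : L // H ≠ ⊥ ∧ H ≠ ⊤} (c ⊥ - 1)) := by
  have hempty {q : ℕ} (hq : c ⊥ ≤ q + 1) (z : Chains {H : L // H ≠ ⊥ ∧ H ≠ ⊤} q) : z = 0 := by
    have : IsEmpty (Simplex {H : L // H ≠ ⊥ ∧ H ≠ ⊤} q) :=
      ⟨fun s => absurd (lt_corank_of_simplex hc s) (by omega)⟩
    exact Subsingleton.elim _ _
  have hfill {m : ℕ} (hm : m + 1 < c ⊥) {z : List L →₀ ℤ}
      (hz : z ∈ supported ℤ ℤ (Strict (⊥ : L) m)) (hd : bd z = 0) :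
      ∃ w, bd (toLists (L := L) m w) = z := by
    obtain ⟨w, hw, hwz⟩ := exists_bd_eq hcov htop _ ⊥ rfl m hm z hz hd
    obtain ⟨v, rfl⟩ := exists_toLists_eq hw
    exact ⟨v, hwz⟩
  constructor
  · intro n hn
    match n with
    | 0 =>
      obtain ⟨w, hw⟩ := hfill (m := 0) (by omega) (single_mem (l := []) (by simp [Strict])) bd_nil
      rw [← single_augment] at hw
      refine Submodule.Quotient.subsingleton_iff.2
        (Ideal.eq_top_of_isUnit_mem _ (LinearMap.mem_range_self _ w) ?_)
      rw [single_injective _ hw]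
      exact isUnit_one
    | 1 =>
      refine Submodule.Quotient.subsingleton_iff.2 (eq_top_iff.2 ?_)
      rintro ⟨z, hz⟩ -
      rw [LinearMap.mem_ker] at hz
      rw [Submodule.mem_comap, LinearMap.mem_range]
      by_cases h : c ⊥ ≤ 1
      · exact ⟨0, by simp [hempty h z]⟩
      · obtain ⟨w, hw⟩ := hfill (by omega) (toLists_mem 0 z) (by rw [← single_augment, hz]; simp)
        exact ⟨w, toLists_injective _ (by rw [toLists_boundary, hw]; rfl)⟩
    | q + 2 =>
      refine Submodule.Quotient.subsingleton_iff.2 (eq_top_iff.2 ?_)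
      rintro ⟨z, hz⟩ -
      rw [LinearMap.mem_ker] at hz
      rw [Submodule.mem_comap, LinearMap.mem_range]
      by_cases h : c ⊥ ≤ q + 2
      · exact ⟨0, by simp [hempty h z]⟩
      · obtain ⟨w, hw⟩ := hfill (by omega) (toLists_mem (q + 1) z)
          (by rw [← toLists_boundary, hz, map_zero])
        exact ⟨w, toLists_injective _ (by rw [toLists_boundary, hw]; rfl)⟩
  · have hfinite (q : ℕ) : Finite (Simplex {H : L // H ≠ ⊥ ∧ H ≠ ⊤} q) :=
      Finite.of_injective Subtype.val Subtype.val_injective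
    have hfree {M : Type} [AddCommGroup M] [Module.Free ℤ M] {N : Submodule ℤ M} (h : N = ⊥) :
        Module.Free ℤ (M ⧸ N) := .of_equiv (N.quotEquivOfEqBot h).symm
    have hrange {q : ℕ} (hq : c ⊥ ≤ q + 1) {M : Type} [AddCommGroup M] (K : Submodule ℤ M)
        (f : Chains {H : L // H ≠ ⊥ ∧ H ≠ ⊤} q →ₗ[ℤ] M) :
        (LinearMap.range f).comap K.subtype = ⊥ := by
      rw [eq_bot_iff]
      rintro x ⟨y, hy⟩
      rw [hempty hq y, map_zero] at hy
      exact Subtype.ext hy.symm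
    obtain ⟨n, hn⟩ : ∃ n, c ⊥ = n + 1 := ⟨c ⊥ - 1, by omega⟩
    rw [hn, Nat.add_sub_cancel]
    match n with
    | 0 =>
      refine hfree (eq_bot_iff.2 ?_)
      rintro _ ⟨y, rfl⟩
      rw [hempty hn.le y, map_zero]
      exact zero_mem _
    | 1 => exact hfree (hrange hn.le _ _)
    | q + 2 => exact hfree (hrange hn.le _ _)

end Comparison

/-- A submodule covering another has dimension one more. -/
lemma finrank_eq_of_covBy {K W : Type} [Field K] [AddCommGroup W] [Module K W]
    [FiniteDimensional K W] {A B : Submodule K W} (h : A ⋖ B) :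
    Module.finrank K B = Module.finrank K A + 1 := by
  obtain ⟨x, hxB, hxA⟩ := SetLike.exists_of_lt h.lt
  have hle : A ⊔ Submodule.span K {x} ≤ B :=
    sup_le h.le ((Submodule.span_singleton_le_iff_mem _ _).2 hxB)
  have hlt : A < A ⊔ Submodule.span K {x} := left_lt_sup.2 fun hx =>
    hxA ((Submodule.span_singleton_le_iff_mem _ _).1 hx)
  rw [← hle.eq_of_not_lt (h.2 hlt)]
  exact Submodule.finrank_sup_span_singleton hxA

end ListChain

open OrderComplex in
/-- for `G ≅ (ℤ/p)^r` (with `r ≥ 1`), the reduced homology of the order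
complex of proper nontrivial subgroups of `G` vanishes outside degree `r - 2` and is a
free abelian group in degree `r - 2`.  Here `reducedHomology V n` is the reduced homology
`H̃_{n-1}` in degree `n - 1`, so the index `n = r - 1` corresponds to degree `r - 2`, and
`n` ranges over all of `ℕ` exactly as the degree `q` ranges over all integers `≥ -1`. -/
theorem stmt_3 (p : ℕ) (hp : p.Prime) (r : ℕ) (hr : 1 ≤ r) (G : Type) [AddCommGroup G]
    (hG : Nonempty (G ≃+ (Fin r → ZMod p))) :
    (∀ n : ℕ, n ≠ r - 1 →
        Subsingleton (reducedHomology {H : AddSubgroup G // H ≠ ⊥ ∧ H ≠ ⊤} n)) ∧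
      Module.Free ℤ (reducedHomology {H : AddSubgroup G // H ≠ ⊥ ∧ H ≠ ⊤} (r - 1)) := by
  have := Fact.mk hp
  obtain ⟨e⟩ := hG
  have : Finite G := Finite.of_equiv _ e.toEquiv.symm
  have : Finite (AddSubgroup G) := Finite.of_injective _ SetLike.coe_injective
  obtain ⟨o⟩ : Nonempty (AddSubgroup G ≃o Submodule (ZMod p) (Fin r → ZMod p)) :=
    ⟨e.mapAddSubgroup.trans (AddSubgroup.toZModSubmodule p)⟩
  let c (H : AddSubgroup G) : ℕ := r - Module.finrank (ZMod p) (o H)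
  have hle (H : AddSubgroup G) : Module.finrank (ZMod p) (o H) ≤ r := by
    simpa using Submodule.finrank_le (o H)
  have hbot : c ⊥ = r := by simp only [c]; rw [o.map_bot, finrank_bot, Nat.sub_zero]
  have h := ListChain.reducedHomology_properPart (c := c) (fun A B h => ?_) (fun A B h => ?_)
    (by simp only [c]; rw [o.map_top]; simp) (hbot ▸ hr)
  · rwa [hbot] at h
  · have h1 := Submodule.finrank_lt_finrank_of_lt (o.lt_iff_lt.2 h)
    have h2 := hle B
    simp only [c]
    omega
  · have h1 := ListChain.finrank_eq_of_covBy ((apply_covBy_apply_iff o).2 h)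
    have h2 := hle B
    simp only [c]
    omega
end

section
/- Let p be a prime, G a nonzero finite abelian p-group, and M an abelian group. Define the cochain complex D^•_G(M) by D^q_G(M) = Hom(C̃_{q−2}(P_G), M) with coboundary induced by the boundary of C̃_{•−2}(P_G). Then: (1) if pG ≠ 0, then H^q(D^•_G(M)) = 0 for all q; (2) if pG = 0, so that G ≅ (ℤ/p)^r, then H^q(D^•_G(M)) = 0 for all q ≠ r. -/
namespace OrderComplex

variable (V : Type) [Preorder V] (M : Type) [AddCommGroup M]

/-- The cochain complex `D^•(M)` with `D^q = Hom(C̃_{q-2}, M)` (so `D^0 = 0`,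
`D^1 = Hom(ℤ, M) ≅ M`, `D^{q+2} = Hom(C̃_q, M)`), with coboundaries dual to the boundary
maps of the augmented chain complex.  `dualCohomology V M q` is its cohomology `H^q`. -/
noncomputable def dualCohomology : ℕ → Type
  | 0 => PUnit
  | 1 => ↥(LinearMap.ker (LinearMap.lcomp ℤ M (augment V)))
  | 2 => ↥(LinearMap.ker (LinearMap.lcomp ℤ M (boundary V 0))) ⧸
      Submodule.comap (LinearMap.ker (LinearMap.lcomp ℤ M (boundary V 0))).subtype
        (LinearMap.range (LinearMap.lcomp ℤ M (augment V)))
  | (q + 3) => ↥(LinearMap.ker (LinearMap.lcomp ℤ M (boundary V (q + 1)))) ⧸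
      Submodule.comap (LinearMap.ker (LinearMap.lcomp ℤ M (boundary V (q + 1)))).subtype
        (LinearMap.range (LinearMap.lcomp ℤ M (boundary V q)))

end OrderComplex

/-! Cochains on an ordered set are handled below as functions on lists. The coboundary is then given by
recursion on the list, and a chain `x₁ < ⋯ < xₙ` is a strictly sorted list. -/

namespace OrderComplex

section ListCochains

variable {L M : Type*} [AddCommGroup M]

/-- The coboundary of a function on lists: the alternating sum of the values of `f` at the lists
obtained by deleting one entry. -/
def coboundary : (List L → M) → List L → M
  | _, [] => 0
  | f, x :: l => f l - coboundary (fun t => f (x :: t)) l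

@[simp]
theorem coboundary_nil (f : List L → M) : coboundary f [] = 0 := rfl

@[simp]
theorem coboundary_cons (f : List L → M) (x : L) (l : List L) :
    coboundary f (x :: l) = f l - coboundary (fun t => f (x :: t)) l := rfl

theorem coboundary_add (f g : List L → M) (l : List L) :
    coboundary (fun t => f t + g t) l = coboundary f l + coboundary g l := by
  induction l generalizing f g with
  | nil => simp
  | cons x l ih => simp only [coboundary_cons, ih]; abel

theorem coboundary_neg (f : List L → M) (l : List L) :
    coboundary (fun t => -f t) l = -coboundary f l := by
  induction l generalizing f with
  | nil => simp
  | cons x l ih => simp only [coboundary_cons, ih]; abel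

theorem coboundary_sub (f g : List L → M) (l : List L) :
    coboundary (fun t => f t - g t) l = coboundary f l - coboundary g l := by
  simp only [sub_eq_add_neg, coboundary_add, coboundary_neg]

theorem coboundary_zero (l : List L) : coboundary (fun _ => (0 : M)) l = 0 := by
  simpa using coboundary_sub (fun _ => (0 : M)) (fun _ => 0) l

theorem coboundary_zsmul (c : ℤ) (f : List L → M) (l : List L) :
    coboundary (fun t => c • f t) l = c • coboundary f l := by
  induction l generalizing f with
  | nil => simp
  | cons x l ih => simp only [coboundary_cons, ih, smul_sub]

theorem coboundary_coboundary (f : List L → M) (l : List L) :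
    coboundary (coboundary f) l = 0 := by
  induction l generalizing f with
  | nil => simp
  | cons x l ih => simp only [coboundary_cons, coboundary_sub, ih]; abel

theorem coboundary_congr {f g : List L → M} {l : List L}
    (h : ∀ t, t.Sublist l → t.length + 1 = l.length → f t = g t) :
    coboundary f l = coboundary g l := by
  induction l generalizing f g with
  | nil => simp
  | cons x l ih =>
    rw [coboundary_cons, coboundary_cons, h l (List.sublist_cons_self x l) rfl,
      ih fun t ht hl => h _ (ht.cons_cons x) (by simp [hl])]

theorem coboundary_append_singleton (f : List L → M) (l : List L) (x : L) :
    coboundary f (l ++ [x]) =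
      coboundary (fun t => f (t ++ [x])) l + (-1 : ℤ) ^ l.length • f l := by
  induction l generalizing f with
  | nil => simp
  | cons y l ih =>
    simp only [List.cons_append, coboundary_cons, ih, List.length_cons, pow_succ, mul_neg, mul_one,
      neg_smul]
    abel

theorem coboundary_comp_reverse (f : List L → M) (l : List L) :
    coboundary (fun t => f t.reverse) l =
      (-1 : ℤ) ^ (l.length + 1) • coboundary f l.reverse := by
  induction l generalizing f with
  | nil => simp
  | cons x l ih =>
    have h := ih fun t => f (t ++ [x])
    simp only [coboundary_cons, List.reverse_cons, coboundary_append_singleton,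
      List.length_reverse, List.length_cons, h, smul_add, smul_smul]
    rcases neg_one_pow_eq_or ℤ l.length with e | e <;> simp [pow_succ, e] <;> abel

end ListCochains

section Exactness

variable {L : Type*}

/-- `l` lists, in increasing order, the `n` elements of a chain in `S`. -/
def IsChainList [Preorder L] (S : Set L) (n : ℕ) (l : List L) : Prop :=
  l.Pairwise (· < ·) ∧ (∀ x ∈ l, x ∈ S) ∧ l.length = n

variable (M : Type*) [AddCommGroup M]

/-- Every cocycle on the `n`-element chains in `S` is a coboundary. -/
def ExactAt [Preorder L] (S : Set L) (n : ℕ) : Prop :=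
  ∀ f : List L → M, (∀ l, IsChainList S (n + 1) l → coboundary f l = 0) →
    ∃ g : List L → M, ∀ l, IsChainList S n l → f l = coboundary g l

variable {M}

section Preorder

variable [Preorder L] {S T : Set L} {n : ℕ} {l : List L} {x : L}

theorem isChainList_cons :
    IsChainList S (n + 1) (x :: l) ↔ x ∈ S ∧ IsChainList (S ∩ Set.Ioi x) n l := by
  simp only [IsChainList, List.pairwise_cons, List.mem_cons, forall_eq_or_imp, List.length_cons,
    Nat.add_right_cancel_iff, Set.mem_inter_iff, Set.mem_Ioi]
  grind

theorem IsChainList.mono (h : IsChainList S n l) (hST : S ⊆ T) : IsChainList T n l :=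
  ⟨h.1, fun x hx => hST (h.2.1 x hx), h.2.2⟩

theorem IsChainList.sublist {t : List L} {m : ℕ} (h : IsChainList S n l) (ht : t.Sublist l)
    (hm : t.length = m) : IsChainList S m t :=
  ⟨h.1.sublist ht, fun x hx => h.2.1 x (ht.subset hx), hm⟩

theorem IsChainList.toDual (h : IsChainList S n l) :
    IsChainList (L := Lᵒᵈ) (OrderDual.ofDual ⁻¹' S) n (l.reverse : List L) :=
  ⟨List.pairwise_reverse.2 h.1, fun x hx => h.2.1 x (List.mem_reverse.1 hx),
    (List.length_reverse (as := l)).trans h.2.2⟩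

theorem ExactAt.of_dual (h : ExactAt M (L := Lᵒᵈ) (OrderDual.ofDual ⁻¹' S) n) : ExactAt M S n := by
  intro f hf
  obtain ⟨(g : List L → M), hg⟩ := h (fun t : List L => f t.reverse) fun l hl => by
    have hl' : IsChainList S (n + 1) (List.reverse l : List L) := hl.toDual
    exact (coboundary_comp_reverse f l).trans (by rw [hf _ hl', smul_zero])
  refine ⟨fun t => (-1 : ℤ) ^ (n + 1) • g t.reverse, fun l hl => ?_⟩
  have e : f l.reverse.reverse = coboundary g l.reverse := hg _ hl.toDual
  rw [coboundary_zsmul, coboundary_comp_reverse, hl.2.2, smul_smul, ← pow_add,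
    Even.neg_one_pow ⟨_, rfl⟩, one_smul, ← e, List.reverse_reverse]

theorem exactAt_of_minimal_compl (hTS : T ⊆ S) (hT : ExactAt M T n)
    (hmin : ∀ x ∈ S, x ∉ T → ∀ y ∈ S, ¬ y < x)
    (hlink : ∀ m, n = m + 1 → ∀ x ∈ S, x ∉ T → ExactAt M (S ∩ Set.Ioi x) m) :
    ExactAt M S n := by
  classical
  intro f hf
  obtain ⟨g₀, hg₀⟩ := hT f fun l hl => hf l (hl.mono hTS)
  rcases n with - | m
  · refine ⟨g₀, fun l hl => hg₀ l ?_⟩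
    obtain rfl := List.length_eq_zero_iff.1 hl.2.2
    exact ⟨List.Pairwise.nil, by simp, rfl⟩
  have hsub : ∀ x ∈ S, S ∩ Set.Ioi x ⊆ T := fun x hx y hy =>
    by_contra fun hyT => hmin y hy.1 hyT x hx hy.2
  let f' : List L → M := fun t => f t - coboundary g₀ t
  have hf'T : ∀ l, IsChainList T (m + 1) l → f' l = 0 := fun l hl => sub_eq_zero.2 (hg₀ l hl)
  have hf' : ∀ l, IsChainList S (m + 2) l → coboundary f' l = 0 := fun l hl => by
    rw [coboundary_sub, hf l hl, coboundary_coboundary, sub_zero]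
  have hex : ∀ x, ∃ g : List L → M, x ∈ S → x ∉ T → ∀ l, IsChainList (S ∩ Set.Ioi x) m l →
      f' (x :: l) = coboundary g l := fun x => by
    by_cases hx : x ∈ S ∧ x ∉ T
    · obtain ⟨g, hg⟩ := hlink m rfl x hx.1 hx.2 (fun t => f' (x :: t)) fun l hl => by
        have e := hf' (x :: l) (isChainList_cons.2 ⟨hx.1, hl⟩)
        rwa [coboundary_cons, hf'T l (hl.mono (hsub x hx.1)), zero_sub, neg_eq_zero] at e
      exact ⟨g, fun _ _ => hg⟩
    · exact ⟨0, fun h h' => absurd ⟨h, h'⟩ hx⟩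
  choose g hg using hex
  let g' : List L → M := fun t => t.casesOn 0 fun x t => if x ∈ T then 0 else -g x t
  have hg'T : ∀ k t, IsChainList T k t → g' t = 0 := by
    rintro k (- | ⟨x, t⟩) ht
    · rfl
    · exact if_pos (ht.2.1 x (by simp))
  refine ⟨fun t => g₀ t + g' t, fun l hl => ?_⟩
  rw [coboundary_add, ← sub_eq_iff_eq_add']
  change f' l = _
  obtain - | ⟨x, l⟩ := l
  · simp [IsChainList] at hl
  obtain ⟨hxS, hl'⟩ := isChainList_cons.1 hl
  rw [coboundary_cons, hg'T m l (hl'.mono (hsub x hxS))]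
  by_cases hxT : x ∈ T
  · simp only [g', if_pos hxT, coboundary_zero, sub_zero]
    exact hf'T _ (isChainList_cons.2 ⟨hxT, hl'.mono fun y hy => ⟨hsub x hxS hy, hy.2⟩⟩)
  · simp only [g', if_neg hxT, coboundary_neg, sub_neg_eq_add, zero_add]
    exact hg x hxS hxT l hl'

end Preorder

theorem exactAt_of_isLeast [PartialOrder L] {S : Set L} {k : L} (hk : IsLeast S k) (n : ℕ) :
    ExactAt M S n := by
  classical
  intro f hf
  refine ⟨fun t => if k ∈ t then 0 else f (k :: t), fun l hl => ?_⟩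
  by_cases hkl : k ∈ l
  · obtain - | ⟨x, l⟩ := l
    · simp at hkl
    obtain ⟨n, rfl⟩ : ∃ m, n = m + 1 := ⟨l.length, hl.2.2.symm⟩
    obtain ⟨hxS, hl'⟩ := isChainList_cons.1 hl
    obtain rfl : k = x := (List.mem_cons.1 hkl).elim id fun h =>
      absurd (hl'.2.1 k h).2 (hk.2 hxS).not_gt
    have hkl' : k ∉ l := fun h => lt_irrefl _ (hl'.2.1 k h).2
    simp [hkl', coboundary_zero]
  · have hc : IsChainList S (n + 1) (k :: l) := isChainList_cons.2 ⟨hk.1, hl.1, fun y hy =>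
      ⟨hl.2.1 y hy, (hk.2 (hl.2.1 y hy)).lt_of_ne fun h => hkl (h ▸ hy)⟩, hl.2.2⟩
    have e := hf _ hc
    rw [coboundary_cons, sub_eq_zero] at e
    rw [e]
    exact coboundary_congr fun t ht _ => (if_neg fun h => hkl (ht.subset h)).symm

theorem exactAt_of_forall_sup_mem [SemilatticeSup L] {S : Set L} (hS : S.Finite) {k : L}
    (hk : k ∈ S) (hsup : ∀ x ∈ S, x ⊔ k ∈ S) (n : ℕ) : ExactAt M S n := by
  induction hN : S.ncard using Nat.strong_induction_on generalizing S k n with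
  | _ N ih =>
    subst hN
    by_cases hle : ∀ x ∈ S, k ≤ x
    · exact exactAt_of_isLeast ⟨hk, hle⟩ n
    push Not at hle
    obtain ⟨x, ⟨hxS, hkx⟩, hxmin⟩ :=
      (hS.subset (Set.sep_subset S fun x => ¬ k ≤ x)).exists_minimal hle
    have hlt : ∀ y ∈ S, ¬ y < x := fun y hy hyx =>
      hyx.not_ge (hxmin ⟨hy, fun hky => hkx (hky.trans hyx.le)⟩ hyx.le)
    refine exactAt_of_minimal_compl Set.sdiff_subset
      (ih _ (Set.ncard_sdiff_singleton_lt_of_mem hxS hS) (hS.subset Set.sdiff_subset)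
        ⟨hk, fun h => hkx (le_of_eq h)⟩
        (fun y hy => ⟨hsup y hy.1, fun h => hkx (le_sup_right.trans_eq h)⟩) n rfl) ?_ ?_
    · intro y hy hyT z hz
      obtain rfl : y = x := by simpa [hy] using hyT
      exact hlt z hz
    · intro m _ y hy hyT
      obtain rfl : y = x := by simpa [hy] using hyT
      refine ih _ (Set.ncard_lt_ncard ⟨Set.inter_subset_left, fun h => lt_irrefl y (h hy).2⟩ hS)
        (hS.subset Set.inter_subset_left) (k := y ⊔ k)
        ⟨hsup y hy, left_lt_sup.2 hkx⟩ (fun z hz => ?_) m rfl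
      have e : z ⊔ (y ⊔ k) = z ⊔ k := by rw [← sup_assoc, sup_eq_left.2 (le_of_lt hz.2)]
      exact ⟨e ▸ hsup z hz.1, lt_of_lt_of_le hz.2 le_sup_left⟩

theorem exactAt_of_forall_inf_mem [SemilatticeInf L] {S : Set L} (hS : S.Finite) {k : L}
    (hk : k ∈ S) (hinf : ∀ x ∈ S, x ⊓ k ∈ S) (n : ℕ) : ExactAt M S n :=
  ExactAt.of_dual (exactAt_of_forall_sup_mem (L := Lᵒᵈ) hS hk hinf n)

theorem exactAt_Ioo_top [Lattice L] [BoundedOrder L] [IsModularLattice L] [Finite L] (d : L → ℕ)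
    (hd : ∀ a b, a ⋖ b → d b ≤ d a + 1) (n : ℕ) (a : L) (h : d a + n + 2 ≤ d ⊤) :
    ExactAt M (Set.Ioo a ⊤) n := by
  induction n using Nat.strong_induction_on generalizing a with
  | _ n ih =>
    obtain rfl | ⟨k, hk, hak⟩ := eq_top_or_exists_le_coatom a
    · omega
    have hak : a < k := hak.lt_of_ne fun e => by
      have := hd a ⊤ (e ▸ hk.covBy_top)
      omega
    have hcov : ∀ x ∈ Set.Ioo a ⊤, x ∉ {x ∈ Set.Ioo a ⊤ | x ⊓ k ≠ a} → a ⋖ x := by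
      intro x hx hxT
      have e : x ⊓ k = a := by simpa [hx.1, hx.2] using hxT
      have hxk : ¬ x ≤ k := fun h => hx.1.ne' (inf_eq_left.2 h ▸ e)
      have hsup : k ⊔ x = ⊤ := hk.2 _ (left_lt_sup.2 hxk)
      rw [← e, inf_comm]
      exact inf_covBy_of_covBy_sup_left (hsup ▸ hk.covBy_top)
    refine exactAt_of_minimal_compl (T := {x ∈ Set.Ioo a ⊤ | x ⊓ k ≠ a}) (Set.sep_subset _ _)
      (exactAt_of_forall_inf_mem (S := {x ∈ Set.Ioo a ⊤ | x ⊓ k ≠ a}) (Set.toFinite _) (k := k)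
        ⟨⟨hak, hk.lt_top⟩, by simpa using hak.ne'⟩ (fun x hx => ?_) n) ?_ ?_
    · obtain ⟨hx, hxk⟩ := hx
      exact ⟨⟨(le_inf hx.1.le hak.le).lt_of_ne hxk.symm, inf_le_left.trans_lt hx.2⟩,
        by rwa [inf_assoc, inf_idem]⟩
    · exact fun x hx hxT y hy hyx => (hcov x hx hxT).2 hy.1 hyx
    · rintro m rfl x hx hxT
      have e : Set.Ioo a ⊤ ∩ Set.Ioi x = Set.Ioo x ⊤ := by
        ext y
        exact ⟨fun h => ⟨h.2, h.1.2⟩, fun h => ⟨⟨hx.1.trans h.1, h.2⟩, h.1⟩⟩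
      have := hd a x (hcov x hx hxT)
      exact e ▸ ih m (Nat.lt_succ_self m) x (by omega)

end Exactness

section Comparison

variable {L M : Type} [AddCommGroup M]

theorem coboundary_ofFn (f : List L → M) {n : ℕ} (s : Fin (n + 1) → L) :
    coboundary f (List.ofFn s) =
      ∑ i : Fin (n + 1), (-1 : ℤ) ^ (i : ℕ) • f (List.ofFn (s ∘ i.succAbove)) := by
  induction n generalizing f with
  | zero => simp [List.ofFn_succ]
  | succ n ih =>
    rw [List.ofFn_succ, coboundary_cons, ih, Fin.sum_univ_succ (n := n + 1), sub_eq_add_neg,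
      ← Finset.sum_neg_distrib]
    congr 1
    · simp [Function.comp_def]
    · refine Finset.sum_congr rfl fun i _ => ?_
      rw [List.ofFn_succ (f := s ∘ i.succ.succAbove)]
      simp [Function.comp_def, pow_succ]

variable [Preorder L] {S : Set L}

/-- The list of vertices of a simplex. -/
def vertexList {q : ℕ} (s : Simplex S q) : List L := List.ofFn fun i => (s.1 i : L)

theorem vertexList_injective {q : ℕ} :
    Function.Injective (vertexList : Simplex S q → List L) := fun _ _ h =>
  Subtype.ext <| funext fun i => Subtype.ext (congrFun (List.ofFn_injective h) i)

theorem isChainList_vertexList {q : ℕ} (s : Simplex S q) :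
    IsChainList S (q + 1) (vertexList s) :=
  ⟨List.pairwise_ofFn.2 fun _ _ h => s.2 h, fun x hx => by
    obtain ⟨i, rfl⟩ := List.mem_ofFn.1 hx
    exact (s.1 i).2, List.length_ofFn⟩

theorem IsChainList.exists_vertexList_eq {q : ℕ} {l : List L} (h : IsChainList S (q + 1) l) :
    ∃ s : Simplex S q, vertexList s = l := by
  obtain ⟨hl, hS, hq⟩ := h
  obtain ⟨s, rfl⟩ : ∃ s : Fin (q + 1) → L, List.ofFn s = l := by
    rw [← hq]
    exact ⟨l.get, List.ofFn_get l⟩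
  exact ⟨⟨fun i => ⟨s i, hS _ (List.mem_ofFn.2 ⟨i, rfl⟩)⟩, fun i j hij =>
    List.pairwise_ofFn.1 hl hij⟩, rfl⟩

theorem coboundary_vertexList {q : ℕ} (f : List L → M) (φ : Chains S q →ₗ[ℤ] M)
    (h : ∀ s, f (vertexList s) = φ (Finsupp.single s 1)) (s : Simplex S (q + 1)) :
    coboundary f (vertexList s) = φ (boundary S q (Finsupp.single s 1)) := by
  rw [vertexList, coboundary_ofFn]
  simp only [boundary, Finsupp.linearCombination_single, one_smul, map_sum, map_smul, ← h]
  rfl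

theorem coboundary_vertexList_zero (f : List L → M) (s : Simplex S 0) :
    coboundary f (vertexList s) = f [] := by
  simp [vertexList, List.ofFn_succ]

/-- The function on lists which agrees with a cochain on chains and vanishes elsewhere. -/
noncomputable def extendCochain {q : ℕ} (φ : Chains S q →ₗ[ℤ] M) : List L → M :=
  Function.extend vertexList (fun s => φ (Finsupp.single s 1)) 0

theorem extendCochain_vertexList {q : ℕ} (φ : Chains S q →ₗ[ℤ] M) (s : Simplex S q) :
    extendCochain φ (vertexList s) = φ (Finsupp.single s 1) :=
  vertexList_injective.extend_apply _ _ _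

/-- The restriction of a function on lists to a cochain. -/
noncomputable def restrictCochain (q : ℕ) (g : List L → M) : Chains S q →ₗ[ℤ] M :=
  Finsupp.linearCombination ℤ fun s => g (vertexList s)

theorem restrictCochain_single {q : ℕ} (g : List L → M) (s : Simplex S q) :
    restrictCochain q g (Finsupp.single s 1) = g (vertexList s) := by
  simp [restrictCochain]

theorem exists_of_exactAt {q : ℕ} (h : ExactAt M S (q + 1)) {φ : Chains S q →ₗ[ℤ] M}
    (hφ : φ ∘ₗ boundary S q = 0) :
    ∃ g : List L → M, ∀ s, φ (Finsupp.single s 1) = coboundary g (vertexList s) := by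
  obtain ⟨g, hg⟩ := h (extendCochain φ) fun l hl => by
    obtain ⟨s, rfl⟩ := hl.exists_vertexList_eq
    rw [coboundary_vertexList _ φ (extendCochain_vertexList φ)]
    exact LinearMap.congr_fun hφ _
  exact ⟨g, fun s => by rw [← hg _ (isChainList_vertexList s), extendCochain_vertexList]⟩

theorem subsingleton_dualCohomology (n : ℕ) (h : ExactAt M S n) :
    Subsingleton (dualCohomology S M (n + 1)) := by
  match n, h with
  | 0, h =>
    refine (Submodule.subsingleton_iff_eq_bot (p := LinearMap.ker _)).2 ?_
    refine LinearMap.ker_eq_bot'.2 fun φ hφ => LinearMap.ext_ring ?_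
    obtain ⟨g, hg⟩ := h (fun _ => φ 1) fun l hl => by
      obtain ⟨s, rfl⟩ := hl.exists_vertexList_eq
      rw [coboundary_vertexList_zero]
      simpa [augment] using LinearMap.congr_fun hφ (Finsupp.single s 1)
    exact hg [] ⟨List.Pairwise.nil, by simp, rfl⟩
  | 1, h =>
    refine Submodule.Quotient.subsingleton_iff.2 (eq_top_iff.2 ?_)
    rintro ⟨φ, hφ⟩ -
    obtain ⟨g, hg⟩ := exists_of_exactAt h hφ
    refine ⟨LinearMap.toSpanSingleton ℤ M (g []), Finsupp.lhom_ext' fun s => LinearMap.ext_ring ?_⟩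
    have e := hg s
    rw [coboundary_vertexList_zero] at e
    simpa [augment] using e.symm
  | n + 2, h =>
    refine Submodule.Quotient.subsingleton_iff.2 (eq_top_iff.2 ?_)
    rintro ⟨φ, hφ⟩ -
    obtain ⟨g, hg⟩ := exists_of_exactAt h hφ
    refine ⟨restrictCochain n g, Finsupp.lhom_ext' fun s => LinearMap.ext_ring ?_⟩
    have e := hg s
    rw [coboundary_vertexList g (restrictCochain n g) fun t => (restrictCochain_single g t).symm]
      at e
    exact e.symm

end Comparison

section Subgroups

variable {G : Type*} [AddCommGroup G] [Finite G] {M : Type*} [AddCommGroup M] {p : ℕ}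

theorem exactAt_subgroups_of_nsmul_ne_zero (hpgrp : ∀ g : G, ∃ n : ℕ, p ^ n • g = 0)
    (hG : ∃ g : G, p • g ≠ 0) (n : ℕ) :
    ExactAt M {H : AddSubgroup G | H ≠ ⊥ ∧ H ≠ ⊤} n := by
  have hbot : ∀ H : AddSubgroup G, H ≠ ⊥ → H ⊓ (nsmulAddMonoidHom p : G →+ G).ker ≠ ⊥ := by
    intro H hH
    obtain ⟨h, hhH, hh⟩ := H.bot_or_exists_ne_zero.resolve_left hH
    classical
    have hn := Nat.find_spec (hpgrp h)
    have hmin := fun m => Nat.find_min (m := m) (hpgrp h)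
    generalize Nat.find (hpgrp h) = n at hn hmin
    obtain - | n := n
    · exact absurd (by simpa using hn) hh
    refine fun e => hmin n n.lt_succ_self ?_
    rw [← AddSubgroup.mem_bot, ← e]
    refine ⟨H.nsmul_mem hhH _, ?_⟩
    change p • p ^ n • h = 0
    rwa [smul_smul, ← pow_succ']
  obtain ⟨g, hg⟩ := hG
  refine exactAt_of_forall_inf_mem (S := {H : AddSubgroup G | H ≠ ⊥ ∧ H ≠ ⊤}) (Set.toFinite _)
    (k := (nsmulAddMonoidHom p : G →+ G).ker)
    ⟨?_, ?_⟩ (fun H hH => ⟨hbot H hH.1, fun e => hH.2 (inf_eq_top_iff.1 e).1⟩) n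
  · have := hbot ⊤ fun e => hg ?_
    · rwa [top_inf_eq] at this
    · exact AddSubgroup.mem_bot.1 (e ▸ AddSubgroup.mem_top (p • g))
  · exact fun e => hg (AddMonoidHom.mem_ker.1 (e ▸ AddSubgroup.mem_top g))

theorem finrank_le_of_covBy {K V : Type*} [Field K] [AddCommGroup V] [Module K V]
    [FiniteDimensional K V] {a b : Submodule K V} (h : a ⋖ b) :
    Module.finrank K b ≤ Module.finrank K a + 1 := by
  obtain ⟨x, hxb, hxa⟩ := SetLike.exists_of_lt h.lt
  have hlt : a < a ⊔ Submodule.span K {x} := left_lt_sup.2 fun hle =>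
    hxa (hle (Submodule.mem_span_singleton_self x))
  have hle : a ⊔ Submodule.span K {x} ≤ b :=
    sup_le h.le ((Submodule.span_singleton_le_iff_mem x b).2 hxb)
  obtain rfl := hle.eq_of_not_lt (h.2 hlt)
  rw [← finrank_span_singleton (K := K) (ne_of_mem_of_not_mem a.zero_mem hxa).symm]
  exact Submodule.finrank_add_le_finrank_add_finrank _ _

theorem exactAt_subgroups_of_zmod [Fact p.Prime] [Module (ZMod p) G] [Nontrivial G] (n : ℕ)
    (hn : n + 1 ≠ Module.finrank (ZMod p) G) :
    ExactAt M {H : AddSubgroup G | H ≠ ⊥ ∧ H ≠ ⊤} n := by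
  let d : AddSubgroup G → ℕ := fun H => Module.finrank (ZMod p) (AddSubgroup.toZModSubmodule p H)
  have hd : StrictMono d := fun H K h =>
    Submodule.finrank_lt_finrank_of_lt ((AddSubgroup.toZModSubmodule p).strictMono h)
  have hbot : d ⊥ = 0 := by simp [d]
  have htop : d ⊤ = Module.finrank (ZMod p) G := finrank_top (ZMod p) G
  have hS : {H : AddSubgroup G | H ≠ ⊥ ∧ H ≠ ⊤} = Set.Ioo ⊥ ⊤ := by
    ext H
    simp [bot_lt_iff_ne_bot, lt_top_iff_ne_top]
  rw [hS]
  rcases hn.lt_or_gt with hlt | hgt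
  · exact exactAt_Ioo_top d (fun a b h => finrank_le_of_covBy
      ((apply_covBy_apply_iff (AddSubgroup.toZModSubmodule p)).2 h)) n ⊥ (by omega)
  · refine fun f _ => ⟨0, fun l hl => ?_⟩
    have hpos : 0 < Module.finrank (ZMod p) G := Module.finrank_pos
    have hnd : (l.map d).Nodup := List.pairwise_map.2 (hl.1.imp fun h => (hd h).ne)
    have hsub : (l.map d).toFinset ⊆ Finset.Ioo 0 (Module.finrank (ZMod p) G) := by
      intro m hm
      obtain ⟨H, hH, rfl⟩ := List.mem_map.1 (List.mem_toFinset.1 hm)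
      exact Finset.mem_Ioo.2 ⟨hbot ▸ hd (hl.2.1 H hH).1, htop ▸ hd (hl.2.1 H hH).2⟩
    have hcard := Finset.card_le_card hsub
    rw [List.toFinset_card_of_nodup hnd, List.length_map, hl.2.2, Nat.card_Ioo] at hcard
    omega

end Subgroups

end OrderComplex

open OrderComplex in
/-- For a nonzero finite abelian `p`-group `G` and abelian group `M`:
(1) if `pG ≠ 0` then `H^q(D^•_G(M)) = 0` for all `q`;
(2) if `G ≅ (ℤ/p)^r` then `H^q(D^•_G(M)) = 0` for all `q ≠ r`. -/
theorem stmt_4 (p : ℕ) (hp : p.Prime) (G : Type) [AddCommGroup G] [Finite G]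
    (hG : Nontrivial G) (hpgrp : ∀ g : G, ∃ n : ℕ, p ^ n • g = 0)
    (M : Type) [AddCommGroup M] :
    ((∃ g : G, p • g ≠ 0) → ∀ q : ℕ,
        Subsingleton (dualCohomology {H : AddSubgroup G // H ≠ ⊥ ∧ H ≠ ⊤} M q)) ∧
      (∀ r : ℕ, Nonempty (G ≃+ (Fin r → ZMod p)) → ∀ q : ℕ, q ≠ r →
        Subsingleton (dualCohomology {H : AddSubgroup G // H ≠ ⊥ ∧ H ≠ ⊤} M q)) := by
  have := Fact.mk hp
  refine ⟨fun hne q => ?_, fun r ⟨e⟩ q hq => ?_⟩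
  · cases q with
    | zero => exact inferInstanceAs (Subsingleton PUnit)
    | succ n => exact subsingleton_dualCohomology n (exactAt_subgroups_of_nsmul_ne_zero hpgrp hne n)
  · cases q with
    | zero => exact inferInstanceAs (Subsingleton PUnit)
    | succ n =>
      have : Module (ZMod p) G := AddCommGroup.zmodModule fun x => e.injective <| by
        ext i
        simp
      have hr : Module.finrank (ZMod p) G = r := by
        have e' : G ≃ₗ[ZMod p] (Fin r → ZMod p) :=
          { e with map_smul' := ZMod.map_smul e.toAddMonoidHom }
        simpa using e'.finrank_eq
      exact subsingleton_dualCohomology n (exactAt_subgroups_of_zmod (p := p) n (hr ▸ hq))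
end

section
/- Let A be an abelian group, k a commutative ring, p a prime, and r ≥ 1. Then the cochain complex 𝒦^•_{p^r}(A;k) has H^q(𝒦^•_{p^r}(A;k)) = 0 for all q ≠ r. -/
namespace KComplex

variable (A : Type) [AddCommGroup A] (p r : ℕ)

def Chain (q : ℕ) : Type :=
  {f : Fin q → AddSubgroup A // StrictMono f ∧ (∀ i, f i ≠ ⊥) ∧
    ∃ i : Fin q, (∀ j, j ≤ i) ∧ Nat.card ↥(f i) = p ^ r}

def face {q : ℕ} (c : Chain A p r (q + 1)) (i : Fin q) : Chain A p r q :=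
  ⟨c.1 ∘ Fin.succAbove i.castSucc,
    c.2.1.comp (Fin.strictMono_succAbove _),
    fun j => c.2.2.1 _, by
      obtain ⟨i₀, hi₀, hcard⟩ := c.2.2.2
      have hq : 0 < q := i.pos
      refine ⟨⟨q - 1, by omega⟩, fun l => Fin.le_def.mpr (by have := l.isLt; simp; omega), ?_⟩
      have h1 : Fin.succAbove i.castSucc ⟨q - 1, by omega⟩ = Fin.last q := by
        have hni : ¬ (Fin.castSucc (⟨q - 1, by omega⟩ : Fin q) < Fin.castSucc i) := by
          simp [Fin.lt_def]
          omega
        rw [Fin.succAbove, if_neg hni]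
        ext
        simp [Fin.last]
        omega
      have h2 : i₀ = Fin.last q := le_antisymm (Fin.le_last _) (hi₀ _)
      simpa [Function.comp, h1, ← h2] using hcard⟩

variable (k : Type) [CommRing k]

/-- `𝒦^q_{p^r}(A; k) = ∏_{chains} k`, the `k`-module of `k`-valued functions on `q`-chains. -/
abbrev KMod (q : ℕ) : Type := Chain A p r q → k

/-- The coboundary `δ : 𝒦^q → 𝒦^{q+1}`:
`(δ f)(G_1,…,G_{q+1}) = ∑_{l=1}^{q} (-1)^l f(G_1,…,Ĝ_l,…,G_{q+1})` (the term omitting the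
largest subgroup `G_{q+1}` does not occur, since the resulting chain no longer has largest
member of order `p^r`). -/
noncomputable def delta (q : ℕ) : KMod A p r k q →ₗ[k] KMod A p r k (q + 1) where
  toFun f := fun c => ∑ i : Fin q, (-1 : k) ^ ((i : ℕ) + 1) * f (face A p r c i)
  map_add' f g := by
    funext c
    simp [mul_add, Finset.sum_add_distrib]
  map_smul' a f := by
    funext c
    simp [Finset.mul_sum, mul_left_comm]

end KComplex

namespace List
variable {α k : Type*} [CommRing k]

/-- The coboundary of a cochain on lists, viewed as simplices of an augmented complex. -/
def coboundary : (List α → k) → List α → k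
  | _, [] => 0
  | f, x :: l => f l - coboundary (fun m => f (x :: m)) l

/-- The prism operator from the identity to `φ`, followed by the cone with apex `c`. -/
def prism (φ : α → α) (c : α) : (List α → k) → List α → k
  | f, [] => f [c]
  | f, x :: l => f (φ x :: x :: l) - prism φ c (fun m => f (φ x :: m)) l

theorem coboundary_sub (f g : List α → k) (l : List α) :
    coboundary (fun m => f m - g m) l = coboundary f l - coboundary g l := by
  induction l generalizing f g with
  | nil => simp [coboundary]
  | cons x l ih => simp only [coboundary, ih]; ring

theorem coboundary_zero (l : List α) : coboundary (fun _ => (0 : k)) l = 0 := by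
  induction l with
  | nil => rfl
  | cons x l ih => simp only [coboundary, ih, sub_zero]

theorem prism_sub (φ : α → α) (c : α) (f g : List α → k) (l : List α) :
    prism φ c (fun m => f m - g m) l = prism φ c f l - prism φ c g l := by
  induction l generalizing f g with
  | nil => simp [prism]
  | cons x l ih => simp only [prism, ih]; ring

theorem coboundary_coboundary (f : List α → k) (l : List α) :
    coboundary (coboundary f) l = 0 := by
  induction l generalizing f with
  | nil => rfl
  | cons x l ih => simp only [coboundary, coboundary_sub, ih]; ring

theorem coboundary_prism_add (φ : α → α) (c : α) (f : List α → k) (l : List α) :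
    coboundary (prism φ c f) l + prism φ c (coboundary f) l = f l := by
  induction l generalizing f with
  | nil => simp [coboundary, prism]
  | cons x l ih =>
    simp only [coboundary, prism, coboundary_sub, prism_sub]
    linear_combination ih (fun m => f (φ x :: m))

theorem coboundary_congr {f g : List α → k} {l : List α}
    (h : ∀ m, m <+ l → m.length + 1 = l.length → f m = g m) :
    coboundary f l = coboundary g l := by
  induction l generalizing f g with
  | nil => rfl
  | cons x l ih =>
    simp only [coboundary]
    rw [h l (sublist_cons_self x l) rfl,
      ih fun m hm hl => h (x :: m) (hm.cons_cons x) (by simpa using hl)]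

theorem coboundary_append_cons_cons {f : List α → k} {x : α} (p t : List α)
    (h : ∀ p t, f (p ++ x :: x :: t) = 0) : coboundary f (p ++ x :: x :: t) = 0 := by
  induction p generalizing f with
  | nil =>
    have : (fun m => f (x :: x :: m)) = fun _ => 0 := funext fun m => h [] m
    simp [coboundary, this, coboundary_zero]
  | cons y p ih =>
    simp only [cons_append, coboundary, h]
    rw [ih fun p t => h (y :: p) t, sub_zero]

theorem coboundary_eq_sum (f : List α → k) (l : List α) :
    coboundary f l = ∑ i : Fin l.length, (-1) ^ (i : ℕ) * f (l.eraseIdx i) := by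
  induction l generalizing f with
  | nil => rfl
  | cons x l ih =>
    rw [coboundary, ih, length_cons, Fin.sum_univ_succ]
    simp [pow_succ, sub_eq_add_neg, Finset.sum_neg_distrib]

theorem prism_eq_zero [PartialOrder α] {φ : α → α} {c u : α} {R : α → Prop}
    (hφ : Monotone φ) (hφx : ∀ x, φ x ≤ x) (hφc : ∀ x, φ x ≤ c) (hc : R c)
    {f : List α → k} {l : List α} (hl : l.Pairwise (· ≤ ·)) (hR : ∀ x ∈ l, R x ∧ R (φ x))
    (huc : u ≤ c) (hu : ∀ x ∈ l, u ≤ φ x)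
    (hf : ∀ m : List α, m.length = l.length + 1 → (u :: m).Pairwise (· ≤ ·) →
      (∀ x ∈ m, R x) → f m = 0) :
    prism φ c f l = 0 := by
  induction l generalizing f u with
  | nil => exact hf [c] rfl (by simpa using huc) (by simpa using hc)
  | cons x l ih =>
    obtain ⟨hx, hl⟩ := pairwise_cons.mp hl
    simp only [forall_mem_cons] at hR hu
    rw [prism, ih hl hR.2 (hφc x) (fun y hy => hφ (hx y hy)), hf, sub_zero]
    · simp
    · have hux := hu.1.trans (hφx x)
      simp only [pairwise_cons, forall_mem_cons]
      exact ⟨⟨hu.1, hux, fun y hy => hux.trans (hx y hy)⟩,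
        ⟨hφx x, fun y hy => (hφx x).trans (hx y hy)⟩, hx, hl⟩
    · simpa [hR.1] using fun y hy => (hR.2 y hy).1
    · intro m hm hs hm'
      refine hf _ (by simpa using hm) ?_ (by simpa [hR.1] using hm')
      have := (pairwise_cons.mp hs).1
      simp only [pairwise_cons, forall_mem_cons]
      exact ⟨⟨hu.1, fun y hy => hu.1.trans (this y hy)⟩, pairwise_cons.mp hs⟩

theorem exists_eq_append_cons_cons_of_not_pairwise_lt [PartialOrder α] {l : List α}
    (hl : l.Pairwise (· ≤ ·)) (h : ¬ l.Pairwise (· < ·)) : ∃ p x t, l = p ++ x :: x :: t := by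
  induction l with
  | nil => simp at h
  | cons x l ih =>
    by_cases h' : l.Pairwise (· < ·)
    · cases l with
      | nil => simp at h
      | cons y l =>
        obtain rfl | hxy := ((pairwise_cons.mp hl).1 y mem_cons_self).eq_or_lt
        · exact ⟨[], x, l, rfl⟩
        · refine absurd (pairwise_cons.mpr ⟨?_, h'⟩) h
          simp only [forall_mem_cons]
          exact ⟨hxy, fun z hz => hxy.trans ((pairwise_cons.mp h').1 z hz)⟩
    · obtain ⟨p, z, t, rfl⟩ := ih (pairwise_cons.mp hl).2 h'
      exact ⟨x :: p, z, t, rfl⟩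

/-- On chains of `(b, T)` whose members do not meet `c` in `b`, every cocycle is a coboundary. -/
theorem exists_eq_coboundary_of_inf_ne [Lattice α] {b c T : α} (hbc : b < c) (hcT : c < T)
    (n : ℕ) (f : List α → k)
    (hf : ∀ l : List α, l.length = n + 1 → l.Pairwise (· < ·) → (∀ x ∈ l, b < x ∧ x < T) →
      coboundary f l = 0) :
    ∃ g : List α → k, ∀ l : List α, l.length = n → l.Pairwise (· < ·) →
      (∀ x ∈ l, b < x ∧ x < T) → (∀ x ∈ l, x ⊓ c ≠ b) → f l = coboundary g l := by
  classical
  let F : List α → k := fun l => if l.Pairwise (· < ·) then f l else 0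
  have hF : ∀ l : List α, l.length = n + 1 → l.Pairwise (· ≤ ·) → (∀ x ∈ l, b < x ∧ x < T) →
      coboundary F l = 0 := by
    intro l hl hs hR
    by_cases h : l.Pairwise (· < ·)
    · rw [← hf l hl h hR]
      exact coboundary_congr fun m hm _ => if_pos (h.sublist hm)
    · obtain ⟨p, x, t, rfl⟩ := exists_eq_append_cons_cons_of_not_pairwise_lt hs h
      refine coboundary_append_cons_cons p t fun p t => if_neg fun h => ?_
      have := (pairwise_append.mp h).2.1
      simp at this
  refine ⟨prism (· ⊓ c) c F, fun l hl hs hR hb => ?_⟩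
  have h0 : prism (· ⊓ c) c (coboundary F) l = 0 := by
    refine prism_eq_zero (u := b) (R := fun x => b < x ∧ x < T)
      (fun x y h => inf_le_inf_right c h) (fun x => inf_le_left) (fun x => inf_le_right)
      ⟨hbc, hcT⟩ (hs.imp le_of_lt) (fun x hx => ⟨hR x hx, ?_, inf_le_right.trans_lt hcT⟩) hbc.le
      (fun x hx => le_inf (hR x hx).1.le hbc.le)
      fun m hm hm' hm'' => hF m (by omega) (pairwise_cons.mp hm').2 hm''
    exact lt_of_le_of_ne (le_inf (hR x hx).1.le hbc.le) (hb x hx).symm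
  have := coboundary_prism_add (· ⊓ c) c F l
  rw [h0, add_zero] at this
  rw [this]
  exact (if_pos hs).symm

/-- In a graded modular lattice, cocycles on the chains of the open interval `(b, T)` are
coboundaries below the top dimension. -/
theorem exists_eq_coboundary [Lattice α] [IsModularLattice α] {T : α} {rk : α → ℕ}
    (hcov : ∀ b < T, ∃ c, b ≤ c ∧ c ⋖ T)
    (hrk : ∀ x y, x ⋖ y → y ≤ T → rk y = rk x + 1)
    (n : ℕ) (b : α) (hbT : b < T) (hn : rk b + n + 1 < rk T) (f : List α → k)
    (hf : ∀ l : List α, l.length = n + 1 → l.Pairwise (· < ·) → (∀ x ∈ l, b < x ∧ x < T) →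
      coboundary f l = 0) :
    ∃ g : List α → k, ∀ l : List α, l.length = n → l.Pairwise (· < ·) →
      (∀ x ∈ l, b < x ∧ x < T) → f l = coboundary g l := by
  classical
  induction n generalizing b f with
  | zero =>
    obtain ⟨c, hbc, hcT⟩ := hcov b hbT
    have hbc : b < c := lt_of_le_of_ne hbc fun h => by
      have := hrk c T hcT le_rfl
      subst h
      omega
    obtain ⟨g, hg⟩ := exists_eq_coboundary_of_inf_ne hbc hcT.lt 0 f hf
    refine ⟨g, fun l hl hs hR => hg l hl hs hR ?_⟩
    simp [List.eq_nil_of_length_eq_zero hl]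
  | succ n ih =>
    obtain ⟨c, hbc, hcT⟩ := hcov b hbT
    have hbc : b < c := lt_of_le_of_ne hbc fun h => by
      have := hrk c T hcT le_rfl
      subst h
      omega
    obtain ⟨g, hg⟩ := exists_eq_coboundary_of_inf_ne hbc hcT.lt (n + 1) f hf
    have hatom : ∀ x, b < x → x < T → x ⊓ c = b → b ⋖ x := by
      intro x hbx hxT hxc
      have hxc' : ¬ x ≤ c := fun h => hbx.ne' (by rwa [inf_eq_left.mpr h] at hxc)
      have hsup : c ⊔ x = T := (hcT.eq_or_eq le_sup_left (sup_le hcT.le hxT.le)).resolve_left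
        fun h => hxc' (h ▸ le_sup_right)
      have : c ⊓ x ⋖ x := inf_covBy_of_covBy_sup_left (by rwa [hsup])
      rwa [inf_comm, hxc] at this
    let f' : List α → k := fun m => f m - coboundary g m
    have hgt : ∀ x y, b < x → x < y → y < T → y ⊓ c ≠ b := fun x y hbx hxy hyT h =>
      (hatom y (hbx.trans hxy) hyT h).2 hbx hxy
    have hx : ∀ x, b < x → x < T → x ⊓ c = b → ∃ g' : List α → k, ∀ l : List α, l.length = n →
        l.Pairwise (· < ·) → (∀ y ∈ l, x < y ∧ y < T) → f' (x :: l) = coboundary g' l := by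
      intro x hbx hxT hxc
      have hrx := hrk b x (hatom x hbx hxT hxc) hxT.le
      refine ih x hxT (by omega) (fun l => f' (x :: l)) fun l hl hs hR => ?_
      have hR' : ∀ y ∈ l, b < y ∧ y < T := fun y hy => ⟨hbx.trans (hR y hy).1, (hR y hy).2⟩
      have h1 : coboundary f' (x :: l) = 0 := by
        rw [coboundary_sub, coboundary_coboundary, sub_zero]
        exact hf _ (by simpa using hl) (pairwise_cons.mpr ⟨fun y hy => (hR y hy).1, hs⟩)
          (by simpa [hbx, hxT] using hR')
      have h2 : f' l = 0 := sub_eq_zero.mpr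
        (hg l hl hs hR' fun y hy => hgt x y hbx (hR y hy).1 (hR y hy).2)
      simpa [coboundary, h2] using h1
    choose! G hG using hx
    let g' : List α → k := fun m => match m with
      | [] => 0
      | x :: m => if x ⊓ c = b then - G x m else 0
    refine ⟨fun m => g m - (0 - g' m), fun l hl hs hR => ?_⟩
    obtain _ | ⟨x, l⟩ := l
    · simp at hl
    have hxl := pairwise_cons.mp hs
    simp only [forall_mem_cons] at hR
    have hl0 : g' l = 0 := by
      obtain _ | ⟨y, l⟩ := l
      · rfl
      · exact if_neg (hgt x y hR.1.1 (hxl.1 y mem_cons_self) (hR.2 y mem_cons_self).2)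
    rw [coboundary_sub, coboundary_sub, coboundary_zero, zero_sub, sub_neg_eq_add,
      ← sub_eq_iff_eq_add']
    change f' (x :: l) = g' l - coboundary (fun m => g' (x :: m)) l
    rw [hl0, zero_sub]
    by_cases hxc : x ⊓ c = b
    · have : (fun m => g' (x :: m)) = fun m => 0 - G x m := by
        funext m
        simp [g', hxc]
      rw [this, coboundary_sub, coboundary_zero, zero_sub, neg_neg]
      exact hG x hR.1.1 hR.1.2 hxc l (by simpa using hl) hxl.2
        fun y hy => ⟨hxl.1 y hy, (hR.2 y hy).2⟩
    · have : (fun m => g' (x :: m)) = fun m => 0 := by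
        funext m
        simp [g', hxc]
      rw [this, coboundary_zero, neg_zero]
      refine sub_eq_zero.mpr (hg _ hl hs (by simpa [hR.1] using hR.2) ?_)
      simp only [forall_mem_cons]
      exact ⟨hxc, fun y hy => hgt x y hR.1.1 (hxl.1 y hy) (hR.2 y hy).2⟩

end List

namespace AddSubgroup

variable {A : Type*} [AddCommGroup A] {p r : ℕ}

theorem card_eq_pow_factorization_of_le (hp : p.Prime) {T x : AddSubgroup A}
    (hT : Nat.card T = p ^ r) (hx : x ≤ T) : Nat.card x = p ^ (Nat.card x).factorization p := by
  obtain ⟨n, -, h⟩ := (Nat.dvd_prime_pow hp).mp (hT ▸ card_dvd_of_le hx)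
  rw [h, hp.factorization_pow]
  simp

theorem factorization_card_lt_of_lt (hp : p.Prime) {T x y : AddSubgroup A}
    (hT : Nat.card T = p ^ r) (hxy : x < y) (hy : y ≤ T) :
    (Nat.card x).factorization p < (Nat.card y).factorization p := by
  have hcx := card_eq_pow_factorization_of_le hp hT (hxy.le.trans hy)
  have hcy := card_eq_pow_factorization_of_le hp hT hy
  have : Finite y := Nat.finite_of_card_ne_zero (hcy ▸ (pow_pos hp.pos _).ne')
  by_contra! h
  refine hxy.ne (eq_of_le_of_card_ge hxy.le ?_)
  rw [hcx, hcy]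
  exact Nat.pow_le_pow_right hp.pos h

theorem exists_prime_card_eq_mul_of_covBy {x y : AddSubgroup A} [Finite y] (hxy : x ⋖ y) :
    ∃ q : ℕ, q.Prime ∧ Nat.card y = q * Nat.card x := by
  have h := (covBy_iff_quot_is_simple (R := ℤ) (toIntSubmodule.monotone hxy.le)).mp
    ((apply_covBy_apply_iff toIntSubmodule).mpr hxy)
  set X := Submodule.comap (toIntSubmodule y).subtype (toIntSubmodule x)
  have : Finite (toIntSubmodule y) := ‹Finite y›
  have := h.toIsSimpleOrder
  have : IsSimpleOrder (AddSubgroup (toIntSubmodule y ⧸ X)) :=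
    (toIntSubmodule (M := toIntSubmodule y ⧸ X)).isSimpleOrder
  have := IsSimpleModule.nontrivial ℤ (toIntSubmodule y ⧸ X)
  have : IsSimpleAddGroup (toIntSubmodule y ⧸ X) := ⟨fun H _ => eq_bot_or_eq_top H⟩
  refine ⟨_, IsSimpleAddGroup.prime_card (α := toIntSubmodule y ⧸ X), ?_⟩
  have hX : Nat.card X = Nat.card x :=
    Nat.card_congr (Submodule.comapSubtypeEquivOfLe (toIntSubmodule.monotone hxy.le)).toEquiv
  rw [← hX, mul_comm]
  exact X.card_eq_card_quotient_mul_card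

theorem factorization_card_eq_succ_of_covBy (hp : p.Prime) {T x y : AddSubgroup A}
    (hT : Nat.card T = p ^ r) (hxy : x ⋖ y) (hy : y ≤ T) :
    (Nat.card y).factorization p = (Nat.card x).factorization p + 1 := by
  have hcx := card_eq_pow_factorization_of_le hp hT (hxy.le.trans hy)
  have hcy := card_eq_pow_factorization_of_le hp hT hy
  have : Finite y := Nat.finite_of_card_ne_zero (hcy ▸ (pow_pos hp.pos _).ne')
  obtain ⟨q, hq, h⟩ := exists_prime_card_eq_mul_of_covBy hxy
  obtain rfl : q = p := (Nat.prime_dvd_prime_iff_eq hq hp).mp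
    (hq.dvd_of_dvd_pow (hcy ▸ Dvd.intro _ h.symm))
  rw [hcy, hcx, ← pow_succ'] at h
  exact Nat.pow_right_injective hp.two_le h

theorem exists_le_covBy_of_lt_of_finite {T x : AddSubgroup A} [Finite T] (h : x < T) :
    ∃ c, x ≤ c ∧ c ⋖ T := by
  have hfin : (Set.Ico x T).Finite := by
    refine Set.Finite.of_finite_image (f := fun y => (y : Set A))
      (((Set.toFinite (T : Set A)).finite_subsets).subset ?_) SetLike.coe_injective.injOn
    rintro _ ⟨y, hy, rfl⟩
    exact hy.2.le
  obtain ⟨c, hxc, hc⟩ := hfin.exists_le_maximal (Set.left_mem_Ico.mpr h)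
  exact ⟨c, hxc, hc.prop.2, fun d hcd hdT => hc.not_gt ⟨hxc.trans hcd.le, hdT⟩ hcd⟩

end AddSubgroup

namespace KComplex

variable {A : Type} [AddCommGroup A] {p r : ℕ} {k : Type} [CommRing k]

namespace Chain

theorem card_last {q : ℕ} (c : Chain A p r (q + 1)) : Nat.card (c.1 (Fin.last q)) = p ^ r := by
  obtain ⟨i, hi, h⟩ := c.2.2.2
  rwa [le_antisymm (Fin.le_last i) (hi _)] at h

theorem isEmpty_zero : IsEmpty (Chain A p r 0) := ⟨fun c => c.2.2.2.choose.elim0⟩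

/-- The members of a chain other than the largest one. -/
def toList {q : ℕ} (c : Chain A p r (q + 1)) : List (AddSubgroup A) :=
  List.ofFn fun i : Fin q => c.1 i.castSucc

theorem toList_face {q : ℕ} (c : Chain A p r (q + 2)) (i : Fin (q + 1)) :
    (face A p r c i).toList = c.toList.eraseIdx i := by
  refine List.ext_getElem (by simp [toList, List.length_eraseIdx, Nat.le_of_lt_succ i.isLt]) fun j h₁ h₂ => ?_
  simp only [toList, List.getElem_ofFn, List.getElem_eraseIdx, face, Function.comp,
    Fin.succAbove, Fin.lt_def]
  split_ifs <;> simp_all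

theorem face_last {q : ℕ} (c : Chain A p r (q + 2)) (i : Fin (q + 1)) :
    (face A p r c i).1 (Fin.last q) = c.1 (Fin.last (q + 1)) := by
  exact congrArg c.1 (by rw [Fin.succAbove_of_le_castSucc _ _ (by simpa using i.le_last),
    Fin.succ_last])

theorem pairwise_toList {q : ℕ} (c : Chain A p r (q + 1)) : c.toList.Pairwise (· < ·) :=
  List.pairwise_ofFn.mpr fun _ _ h => c.2.1 (Fin.castSucc_lt_castSucc_iff.mpr h)

theorem mem_toList {q : ℕ} (c : Chain A p r (q + 1)) :
    ∀ x ∈ c.toList, ⊥ < x ∧ x < c.1 (Fin.last q) := by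
  intro x hx
  obtain ⟨i, rfl⟩ := List.mem_ofFn.mp hx
  exact ⟨(c.2.2.1 _).bot_lt, c.2.1 (Fin.castSucc_lt_last i)⟩

theorem succ_le {q : ℕ} (hp : p.Prime) (c : Chain A p r (q + 1)) : q + 1 ≤ r := by
  have hle : ∀ i, c.1 i ≤ c.1 (Fin.last q) := fun i => c.2.1.monotone (Fin.le_last i)
  have hlt : ∀ i : Fin (q + 1), (i : ℕ) < (Nat.card (c.1 i)).factorization p := by
    intro i
    induction i using Fin.induction with
    | zero =>
      have := AddSubgroup.factorization_card_lt_of_lt hp c.card_last (c.2.2.1 0).bot_lt (hle 0)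
      exact (Nat.zero_le _).trans_lt this
    | succ i ih =>
      have := AddSubgroup.factorization_card_lt_of_lt hp c.card_last
        (c.2.1 i.castSucc_lt_succ) (hle i.succ)
      simp only [Fin.val_castSucc, Fin.val_succ] at ih ⊢
      omega
  have := hlt (Fin.last q)
  rw [c.card_last, hp.factorization_pow] at this
  simpa using this

theorem exists_toList_eq {q : ℕ} {H : AddSubgroup A} (hH : Nat.card H = p ^ r) (hH0 : H ≠ ⊥)
    {l : List (AddSubgroup A)} (hl : l.length = q) (hs : l.Pairwise (· < ·))
    (hR : ∀ x ∈ l, ⊥ < x ∧ x < H) :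
    ∃ c : Chain A p r (q + 1), c.toList = l ∧ c.1 (Fin.last q) = H := by
  subst hl
  refine ⟨⟨Fin.snoc (α := fun _ => AddSubgroup A) l.get H, ?_, fun i => ?_, Fin.last _,
    Fin.le_last, ?_⟩, ?_, ?_⟩
  · intro i j hij
    induction j using Fin.lastCases with
    | last =>
      induction i using Fin.lastCases with
      | last => exact absurd hij (lt_irrefl _)
      | cast i => simpa using (hR _ (l.get_mem i)).2
    | cast j =>
      induction i using Fin.lastCases with
      | last => exact absurd hij (Fin.le_last _).not_gt
      | cast i => simpa using List.pairwise_iff_get.mp hs i j (by simpa using hij)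
  · induction i using Fin.lastCases with
    | last => simpa using hH0
    | cast i => simpa using (hR _ (l.get_mem i)).1.ne'
  · rw [Fin.snoc_last, hH]
  · simp [toList]
  · simp

end Chain

open Classical in
/-- The cochain on lists of subgroups below `H` given by appending `H`. -/
noncomputable def restrict {q : ℕ} (f : KMod A p r k (q + 1)) (H : AddSubgroup A)
    (l : List (AddSubgroup A)) : k :=
  if h : ∃ c : Chain A p r (q + 1), c.toList = l ∧ c.1 (Fin.last q) = H then f h.choose else 0

theorem restrict_toList {q : ℕ} (f : KMod A p r k (q + 1)) (c : Chain A p r (q + 1)) :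
    restrict f (c.1 (Fin.last q)) c.toList = f c := by
  have h : ∃ c' : Chain A p r (q + 1), c'.toList = c.toList ∧
    c'.1 (Fin.last q) = c.1 (Fin.last q) := ⟨c, rfl, rfl⟩
  rw [restrict, dif_pos h]
  congr 1
  refine Subtype.ext (funext fun i => ?_)
  induction i using Fin.lastCases with
  | last => exact h.choose_spec.2
  | cast i => exact congrFun (List.ofFn_injective h.choose_spec.1) i

theorem delta_apply_eq {q : ℕ} (f : KMod A p r k (q + 1)) (c : Chain A p r (q + 2))
    (F : List (AddSubgroup A) → k)
    (hF : ∀ c' : Chain A p r (q + 1), c'.1 (Fin.last q) = c.1 (Fin.last (q + 1)) →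
      f c' = F c'.toList) :
    delta A p r k (q + 1) f c = - List.coboundary F c.toList := by
  rw [List.coboundary_eq_sum, ← Finset.sum_neg_distrib]
  refine Fintype.sum_equiv (finCongr (by simp [Chain.toList])) _ _ fun i => ?_
  rw [hF _ (c.face_last i), Chain.toList_face]
  simp [pow_succ]

end KComplex

open KComplex in
/-- `H^q(𝒦^•_{p^r}(A;k)) = 0` for all `q ≠ r`.  Cohomology is `ker δ / im δ`;
at `q = 0` it is just `ker δ⁰` (note `𝒦⁰ = 0`, the empty product, since a `0`-chain has no
largest member of order `p^r`). -/
theorem stmt_5 (A : Type) [AddCommGroup A] (k : Type) [CommRing k]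
    (p : ℕ) (hp : p.Prime) (r : ℕ) (hr : 1 ≤ r) :
    Subsingleton ↥(LinearMap.ker (delta A p r k 0)) ∧
      ∀ q : ℕ, q + 1 ≠ r →
        Subsingleton (↥(LinearMap.ker (delta A p r k (q + 1))) ⧸
          Submodule.comap (LinearMap.ker (delta A p r k (q + 1))).subtype
            (LinearMap.range (delta A p r k q))) := by
  have h0 := Chain.isEmpty_zero (A := A) (p := p) (r := r)
  refine ⟨inferInstance, fun q hq => ?_⟩
  rw [Submodule.Quotient.subsingleton_iff, eq_top_iff]
  rintro ⟨f, hf⟩ -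
  rw [LinearMap.mem_ker] at hf
  change f ∈ LinearMap.range _
  obtain hrq | hqr := lt_or_gt_of_ne hq.symm
  · have : IsEmpty (Chain A p r (q + 1)) := ⟨fun c => (c.succ_le hp).not_gt hrq⟩
    exact ⟨0, Subsingleton.elim _ _⟩
  have key : ∀ H : AddSubgroup A, Nat.card H = p ^ r → ∃ g : List (AddSubgroup A) → k,
      ∀ l : List (AddSubgroup A), l.length = q → l.Pairwise (· < ·) →
        (∀ x ∈ l, ⊥ < x ∧ x < H) → restrict f H l = List.coboundary g l := by
    intro H hH
    have : Finite H := Nat.finite_of_card_ne_zero (hH ▸ (pow_pos hp.pos _).ne')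
    have hH0 : H ≠ ⊥ := by
      rintro rfl
      rw [AddSubgroup.card_bot] at hH
      exact (Nat.one_lt_pow (by omega) hp.one_lt).ne hH
    refine List.exists_eq_coboundary (rk := fun x : AddSubgroup A => (Nat.card x).factorization p)
      (fun b hb => AddSubgroup.exists_le_covBy_of_lt_of_finite hb)
      (fun x y => AddSubgroup.factorization_card_eq_succ_of_covBy hp hH) q ⊥ hH0.bot_lt
      ?_ _ fun l hl hs hR => ?_
    · rw [hH, hp.factorization_pow]
      simpa using hqr
    · obtain ⟨c, rfl, rfl⟩ := Chain.exists_toList_eq hH hH0 hl hs hR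
      have := delta_apply_eq f c (restrict f (c.1 (Fin.last (q + 1))))
        fun c' h => by rw [← h, restrict_toList]
      rw [hf] at this
      simpa using this.symm
  choose! G hG using key
  have hfG : ∀ c : Chain A p r (q + 1),
      f c = List.coboundary (G (c.1 (Fin.last q))) c.toList := by
    intro c
    rw [← restrict_toList f c]
    exact hG _ c.card_last _ (by simp [Chain.toList]) c.pairwise_toList c.mem_toList
  obtain _ | q := q
  · refine ⟨0, funext fun c => ?_⟩
    rw [hfG, map_zero]
    rfl
  · refine ⟨fun c => - G (c.1 (Fin.last q)) c.toList, funext fun c => ?_⟩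
    rw [hfG, delta_apply_eq _ c (fun l => 0 - G (c.1 (Fin.last (q + 1))) l)
      fun c' h => by rw [h, zero_sub], List.coboundary_sub, List.coboundary_zero, zero_sub, neg_neg]
end

section
/- Let p be a prime, k a field of characteristic p, and r ≥ 1. The k-algebra homomorphism k[z]/(z^{1+p+⋯+p^{r+1}}) → k[y,z]/(y^{1+p}, F_{p^r}(y,z)) determined by z ↦ z is injective. -/
open MvPolynomial

/-- `F_{p^r}(y,z) = ∏_{i+j=r} (y^{p^i} - z^{p^j})` in `k[y,z]`, where `y = X 0`, `z = X 1`. -/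
noncomputable def FprMv (k : Type*) [CommRing k] (p r : ℕ) : MvPolynomial (Fin 2) k :=
  ∏ i ∈ Finset.range (r + 1),
    ((X 0 : MvPolynomial (Fin 2) k) ^ p ^ i - (X 1 : MvPolynomial (Fin 2) k) ^ p ^ (r - i))

/-- The ideal `(y^{1+p}, F_{p^r}(y,z))` of `k[y,z]`. -/
noncomputable def targetIdeal (k : Type*) [CommRing k] (p r : ℕ) :
    Ideal (MvPolynomial (Fin 2) k) :=
  Ideal.span {(X 0 : MvPolynomial (Fin 2) k) ^ (1 + p), FprMv k p r}

section Relation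

variable {R : Type*} [CommRing R] {y z : R} {p a M : ℕ}

theorem pow_add_mul_eq_of_relation (hp : 2 ≤ p) (hy : y ^ (p + 1) = 0)
    (h : z ^ (M + a + a * p) = y * z ^ (M + a) + y ^ p * z ^ (M + a * p)) (s : ℕ) :
    z ^ (M + a + (s + 2) * (a * p)) = y ^ (s + 2) * z ^ (M + a) := by
  have hyD : y ^ p * z ^ (M + a + a * p) = 0 := by
    rw [h]
    linear_combination (z ^ (M + a) + y ^ (p - 1) * z ^ (M + a * p)) * hy +
      z ^ (M + a * p) * (y ^ p * (pow_sub_one_mul (by omega : p ≠ 0) y).symm)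
  have hle : a ≤ a * p := Nat.le_mul_of_pos_right a (by omega)
  have hy2 : y ^ p * z ^ (M + 2 * (a * p)) = 0 := by
    rw [show M + 2 * (a * p) = M + a + a * p + (a * p - a) by omega, pow_add, ← mul_assoc, hyD,
      zero_mul]
  induction s with
  | zero =>
    calc z ^ (M + a + (0 + 2) * (a * p)) = z ^ (a * p) * z ^ (M + a + a * p) := by ring
      _ = y * z ^ (M + a + a * p) + y ^ p * z ^ (M + 2 * (a * p)) := by
        linear_combination z ^ (a * p) * h
      _ = y ^ 2 * z ^ (M + a) + y ^ (p + 1) * z ^ (M + a * p) := by rw [hy2, h]; ring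
      _ = y ^ (0 + 2) * z ^ (M + a) := by rw [hy]; ring
  | succ s ih =>
    calc z ^ (M + a + (s + 1 + 2) * (a * p))
        = z ^ (a * p) * z ^ (M + a + (s + 2) * (a * p)) := by ring
      _ = y ^ (s + 2) * z ^ (M + a + a * p) := by rw [ih]; ring
      _ = y ^ (s + 1 + 2) * z ^ (M + a) + y ^ (p + 1) * (y ^ (s + 1) * z ^ (M + a * p)) := by
        rw [h]; ring
      _ = y ^ (s + 1 + 2) * z ^ (M + a) := by rw [hy]; ring

theorem pow_mul_eq_of_relation (hp : 2 ≤ p) (ha : 0 < a) (hM : p * M + 1 = M + a)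
    (hy : y ^ (p + 1) = 0)
    (h : z ^ (M + a + a * p) = y * z ^ (M + a) + y ^ p * z ^ (M + a * p)) :
    z ^ (p * (M + a + a * p)) = y ^ p * z ^ (M + a + a * p - 1) := by
  obtain ⟨s, rfl⟩ := Nat.exists_eq_add_of_le' hp
  have hpos : 0 < a * (s + 2) := by positivity
  have e : (s + 2) * (M + a + a * (s + 2)) =
      M + a + (s + 2) * (a * (s + 2)) + (a * (s + 2) - 1) := by
    zify [show 1 ≤ a * (s + 2) from hpos] at hM ⊢
    linear_combination hM
  rw [e, pow_add, pow_add_mul_eq_of_relation hp hy h s, mul_assoc, ← pow_add,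
    Nat.add_sub_assoc hpos]

end Relation

theorem Polynomial.Monic.not_dvd_C_mul_X_pow_natDegree_sub_one {A : Type*} [CommRing A] {c : A}
    (hc : c ≠ 0) {G : Polynomial A} (hG : G.Monic) (hd : 0 < G.natDegree) :
    ¬ G ∣ Polynomial.C c * Polynomial.X ^ (G.natDegree - 1) := by
  refine hG.not_dvd_of_natDegree_lt ?_ ?_
  · rw [Ne, ← Polynomial.leadingCoeff_eq_zero, Polynomial.leadingCoeff_C_mul_X_pow]
    exact hc
  · rw [Polynomial.natDegree_C_mul_X_pow _ _ hc]
    omega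

/-- The image of `F_{p^{n+1}}` is a unit times a trinomial once `y^{1+p} = 0`. -/
theorem aeval_FprMv_of_pow_eq_zero {k R : Type*} [CommRing k] [CommRing R] [Algebra k R]
    {p : ℕ} (hp : 2 ≤ p) (n : ℕ) {v : Fin 2 → R} (hy : v 0 ^ (p + 1) = 0) :
    aeval v (FprMv k p (n + 1)) = (-1) ^ n *
      (v 1 ^ ((∑ s ∈ Finset.range n, p ^ s) + p ^ n + p ^ n * p) -
        v 0 * v 1 ^ ((∑ s ∈ Finset.range n, p ^ s) + p ^ n) -
        v 0 ^ p * v 1 ^ ((∑ s ∈ Finset.range n, p ^ s) + p ^ n * p)) := by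
  have htail : ∏ i ∈ Finset.range n, (v 0 ^ p ^ (i + 1 + 1) - v 1 ^ p ^ (n + 1 - (i + 1 + 1))) =
      (-1) ^ n * v 1 ^ ∑ s ∈ Finset.range n, p ^ s := by
    rw [← Finset.sum_range_reflect, ← Finset.prod_pow_eq_pow_sum,
      show (-1 : R) ^ n = ∏ _i ∈ Finset.range n, (-1) by simp, ← Finset.prod_mul_distrib]
    refine Finset.prod_congr rfl fun i _ => ?_
    have hle : p + 1 ≤ p ^ (i + 1 + 1) :=
      calc p + 1 ≤ p ^ 2 := by nlinarith
        _ ≤ p ^ (i + 1 + 1) := Nat.pow_le_pow_right (by omega) (by omega)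
    rw [pow_eq_zero_of_le hle hy, show n + 1 - (i + 1 + 1) = n - 1 - i by omega]
    ring
  simp only [FprMv, map_prod, map_sub, map_pow, aeval_X]
  rw [Finset.prod_range_succ', Finset.prod_range_succ', htail]
  simp only [zero_add, pow_zero, pow_one, Nat.add_sub_cancel, Nat.sub_zero]
  linear_combination (-1) ^ n * v 1 ^ (∑ s ∈ Finset.range n, p ^ s) * hy

theorem X_pow_notMem_targetIdeal (k : Type*) [Field k] {p : ℕ} (hp : 2 ≤ p) (n : ℕ) :
    (X 1 : MvPolynomial (Fin 2) k) ^ (p * ∑ s ∈ Finset.range (n + 2), p ^ s) ∉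
      targetIdeal k p (n + 1) := by
  intro hmem
  let A := AdjoinRoot (Polynomial.X ^ (p + 1) : Polynomial k)
  let t : A := AdjoinRoot.root _
  have ht : t ^ (p + 1) = 0 := by
    simpa [t] using AdjoinRoot.eval₂_root (Polynomial.X ^ (p + 1) : Polynomial k)
  have ht' : t ^ p ≠ 0 := by
    rw [show t ^ p = AdjoinRoot.mk _ (Polynomial.X ^ p) by simp [t], Ne, AdjoinRoot.mk_eq_zero,
      Polynomial.X_pow_dvd_iff]
    intro h
    simpa using h p (by omega)
  have : Nontrivial A := ⟨_, _, ht'⟩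
  set M := ∑ s ∈ Finset.range n, p ^ s with hMdef
  set a := p ^ n with hadef
  have ha : 0 < a := by positivity
  have hM : p * M + 1 = M + a := by
    rw [hMdef, hadef, ← Finset.sum_range_succ, Finset.sum_range_succ', Finset.mul_sum]
    simp [pow_succ']
  have hD : ∑ s ∈ Finset.range (n + 2), p ^ s = M + a + a * p := by
    rw [Finset.sum_range_succ, Finset.sum_range_succ, pow_succ]
  let G : Polynomial A := Polynomial.X ^ (M + a + a * p) -
    (Polynomial.C t * Polynomial.X ^ (M + a) +
      Polynomial.C (t ^ p) * Polynomial.X ^ (M + a * p))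
  have hlt : (Polynomial.C t * Polynomial.X ^ (M + a) +
      Polynomial.C (t ^ p) * Polynomial.X ^ (M + a * p)).degree < ((M + a + a * p : ℕ) :
        WithBot ℕ) := by
    have hap : 0 < a * p := by positivity
    refine (Polynomial.degree_add_le _ _).trans_lt (max_lt ?_ ?_)
    · exact (Polynomial.degree_C_mul_X_pow_le _ _).trans_lt (by exact_mod_cast (by omega))
    · exact (Polynomial.degree_C_mul_X_pow_le _ _).trans_lt (by exact_mod_cast (by omega))
  have hG : G.Monic := Polynomial.monic_X_pow_sub hlt
  have hGdeg : G.natDegree = M + a + a * p := Polynomial.natDegree_eq_of_degree_eq_some <| by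
    rw [Polynomial.degree_sub_eq_left_of_degree_lt (by rwa [Polynomial.degree_X_pow]),
      Polynomial.degree_X_pow]
  let v : Fin 2 → Polynomial A := ![Polynomial.C t, Polynomial.X]
  have hv : v 0 ^ (p + 1) = 0 := by simp [v, ← Polynomial.C_pow, ht]
  have hle : targetIdeal k p (n + 1) ≤ (Ideal.span {G}).comap (aeval v : _ →ₐ[k] _) := by
    rw [targetIdeal, Ideal.span_le]
    rintro x (rfl | rfl)
    · simp only [SetLike.mem_coe, Ideal.mem_comap, map_pow, aeval_X]
      rw [show v 0 ^ (1 + p) = 0 by rw [Nat.add_comm 1 p, hv]]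
      exact zero_mem _
    · simp only [SetLike.mem_coe, Ideal.mem_comap]
      rw [aeval_FprMv_of_pow_eq_zero hp n hv]
      refine Ideal.mul_mem_left _ _ (Ideal.mem_span_singleton.2 (dvd_of_eq ?_))
      simp [G, v, M, a, sub_sub]
  have hmem' := hle hmem
  rw [Ideal.mem_comap, map_pow, aeval_X, hD, ← Ideal.Quotient.eq_zero_iff_mem, map_pow] at hmem'
  have hrel := pow_mul_eq_of_relation (y := Ideal.Quotient.mk (Ideal.span {G}) (v 0))
    (z := Ideal.Quotient.mk (Ideal.span {G}) (v 1)) hp ha hM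
    (by rw [← map_pow, hv, map_zero]) (by
      simp only [← map_pow, ← map_mul, ← map_add]
      rw [Ideal.Quotient.eq, Ideal.mem_span_singleton]
      simp [G, v])
  rw [hmem', ← map_pow, ← map_pow, ← map_mul, eq_comm, Ideal.Quotient.eq_zero_iff_mem,
    Ideal.mem_span_singleton] at hrel
  refine hG.not_dvd_C_mul_X_pow_natDegree_sub_one ht' (by rw [hGdeg]; omega) ?_
  simpa [hGdeg, v] using hrel

/-- A ring homomorphism from `k[X]/(X^{N+1})` that does not kill `X^N` is injective. -/
theorem injective_of_map_mk_X_pow_ne_zero {k B : Type*} [Field k] [CommRing B] {N : ℕ}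
    (ψ : (Polynomial k ⧸ Ideal.span {(Polynomial.X : Polynomial k) ^ (N + 1)}) →+* B)
    (h : ψ (Ideal.Quotient.mk _ (Polynomial.X ^ N)) ≠ 0) : Function.Injective ψ := by
  rw [injective_iff_map_eq_zero]
  intro x hx
  obtain ⟨f, rfl⟩ := Ideal.Quotient.mk_surjective x
  rw [Ideal.Quotient.eq_zero_iff_mem, Ideal.mem_span_singleton]
  by_contra hf
  have hf0 : f ≠ 0 := by rintro rfl; exact hf (dvd_zero _)
  obtain ⟨g, hfg, hg⟩ := f.exists_eq_pow_rootMultiplicity_mul_and_not_dvd hf0 0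
  rw [Polynomial.C_0, sub_zero] at hfg hg
  generalize f.rootMultiplicity 0 = m at hfg
  subst hfg
  have hm : m ≤ N := by
    by_contra hm
    exact hf ((pow_dvd_pow _ (by omega)).mul_right g)
  obtain ⟨u, w, huw⟩ : IsCoprime (Polynomial.X ^ (N + 1)) g :=
    ((Polynomial.irreducible_X.coprime_iff_not_dvd).2 hg).pow_left
  refine h ?_
  have e : Ideal.Quotient.mk (Ideal.span {(Polynomial.X : Polynomial k) ^ (N + 1)})
      (Polynomial.X ^ N) = Ideal.Quotient.mk _ (Polynomial.X ^ (N - m) * w) *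
        Ideal.Quotient.mk _ (Polynomial.X ^ m * g) := by
    rw [← map_mul, Ideal.Quotient.eq, Ideal.mem_span_singleton]
    refine ⟨Polynomial.X ^ N * u, ?_⟩
    have hs : (Polynomial.X : Polynomial k) ^ (N - m) * Polynomial.X ^ m = Polynomial.X ^ N := by
      rw [← pow_add, Nat.sub_add_cancel hm]
    linear_combination (-w * g) * hs - Polynomial.X ^ N * huw
  rw [e, map_mul, hx, mul_zero]

theorem stmt_12 (p : ℕ) (hp : p.Prime) (k : Type*) [Field k] [CharP k p]
    (r : ℕ) (hr : 1 ≤ r)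
    (ψ : (Polynomial k ⧸ Ideal.span {(Polynomial.X : Polynomial k) ^
            (∑ s ∈ Finset.range (r + 2), p ^ s)}) →ₐ[k]
          (MvPolynomial (Fin 2) k ⧸ targetIdeal k p r))
    (hψ : ψ (Ideal.Quotient.mk _ Polynomial.X) =
        Ideal.Quotient.mk _ (X 1 : MvPolynomial (Fin 2) k)) :
    Function.Injective ψ := by
  obtain ⟨n, rfl⟩ := Nat.exists_eq_add_of_le' hr
  have hN : ∑ s ∈ Finset.range (n + 1 + 2), p ^ s =
      p * (∑ s ∈ Finset.range (n + 2), p ^ s) + 1 := by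
    rw [Finset.sum_range_succ', Finset.mul_sum]
    simp [pow_succ']
  have hnot := X_pow_notMem_targetIdeal k hp.two_le n
  revert ψ
  rw [hN]
  intro ψ hψ
  refine injective_of_map_mk_X_pow_ne_zero ψ.toRingHom ?_
  rw [AlgHom.toRingHom_eq_coe, RingHom.coe_coe, map_pow, map_pow, hψ, ← map_pow, Ne, Ideal.Quotient.eq_zero_iff_mem]
  exact hnot
end
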